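/- Let p_R = B/(4R) (with the truncation convention) for some B > 1, and let N ≥ 2 be an integer. Then: (i) with probability 1 there exist infinitely many R such that ξ(R+j,∞) = 1 for every j = 0,1,…,⌊g(N,R)⌋; (ii) for every ε > 0, with probability 1, for all sufficiently large R there exists an integer S with R ≤ S ≤ R + f(N,R,ε) such that ξ(S,∞) > 1. -/

import Mathlib

open MeasureTheory Filter Finset
open scoped ENNReal NNReal Topology

noncomputable section

namespace NNRW

/-- Probability of a step to the right from site `i`: `E 0 = 1`, `E i = 1/2 + p i` for `i ≥ 1`. -/
def E (p : ℕ → ℝ) (i : ℕ) : ℝ := if i = 0 then 1 else 1 / 2 + p i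

/-- One-step transition probability of the nearest-neighbour walk, from `i` to `j`. -/
def step (p : ℕ → ℝ) (i j : ℕ) : ℝ :=
  if j = i + 1 then E p i else if j + 1 = i then 1 - E p i else 0

/-- `X` is (distributed as) the nearest-neighbour Markov chain with parameters `p`, started
at `b`, under the probability measure `P`: `X 0 = b` and the finite-dimensional
distributions are the products of the one-step transition probabilities. -/
def IsNNWalk {Ω : Type*} [MeasurableSpace Ω] (P : Measure Ω)
    (X : ℕ → Ω → ℕ) (p : ℕ → ℝ) (b : ℕ) : Prop :=
  (∀ ω, X 0 ω = b) ∧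
    ∀ (n : ℕ) (u : ℕ → ℕ), u 0 = b →
      P {ω | ∀ k ≤ n, X k ω = u k} =
        ENNReal.ofReal (∏ k ∈ Finset.range n, step p (u k) (u (k + 1)))

/-- `U i = (1/2 - p i)/(1/2 + p i)`. -/
def U (p : ℕ → ℝ) (i : ℕ) : ℝ := (1 / 2 - p i) / (1 / 2 + p i)

/-- `D(m,n)` for finite `m ≤ n`. -/
def Dfin (p : ℕ → ℝ) (m n : ℕ) : ℝ :=
  if n = m then 0
  else 1 + ∑ j ∈ Finset.Icc 1 (n - m - 1), ∏ i ∈ Finset.Icc 1 j, U p (m + i)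

/-- `D(m,∞) = lim_{n → ∞} D(m,n) ∈ (0,∞]`. -/
def Dinf (p : ℕ → ℝ) (m : ℕ) : ℝ≥0∞ :=
  1 + ∑' j : ℕ, ENNReal.ofReal (∏ i ∈ Finset.Icc 1 (j + 1), U p (m + i))

/-- Event: the walk visits `a` (strictly) before it ever visits `c`. -/
def hitsBefore {Ω : Type*} (X : ℕ → Ω → ℕ) (a c : ℕ) : Set Ω :=
  {ω | ∃ n, X n ω = a ∧ ∀ k < n, X k ω ≠ c}

/-- Event: the walk ever visits `a`. -/
def hits {Ω : Type*} (X : ℕ → Ω → ℕ) (a : ℕ) : Set Ω := {ω | ∃ n, X n ω = a}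

/-- Total local time `ξ(x,∞)` at site `x` (equal to `∞` if there are infinitely many
visits). -/
def localTime {Ω : Type*} (X : ℕ → Ω → ℕ) (x : ℕ) (ω : Ω) : ℝ≥0∞ :=
  ∑' k : ℕ, Set.indicator {k | X k ω = x} (fun _ => (1 : ℝ≥0∞)) k

/-- Total number of upcrossings `ξ(x,∞,↑)` at site `x`. -/
def upcross {Ω : Type*} (X : ℕ → Ω → ℕ) (x : ℕ) (ω : Ω) : ℝ≥0∞ :=
  ∑' k : ℕ, Set.indicator {k | X k ω = x ∧ X (k + 1) ω = x + 1} (fun _ => (1 : ℝ≥0∞)) k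

/-- Iterated logarithm: `iterLog 0 x = x`, `iterLog (k+1) x = log (iterLog k x)`. -/
def iterLog : ℕ → ℝ → ℝ
  | 0, x => x
  | k + 1, x => Real.log (iterLog k x)

/-- `λ(k,x)`: `lam 0 x = 1`, `lam (k+1) x = lam k x * log_k x`. -/
def lam : ℕ → ℝ → ℝ
  | 0, _ => 1
  | k + 1, x => lam k x * iterLog k x

/-- `Λ(K,x,B) = Λ(K-1,x) + B/λ(K,x)` where `Λ(K,x) = ∑_{k=1}^{K} 1/λ(k,x)`. -/
def LamB (K : ℕ) (B : ℝ) (x : ℝ) : ℝ :=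
  (∑ k ∈ Finset.Icc 1 (K - 1), 1 / lam k x) + B / lam K x

/-- The truncation convention: with `i₀ = min{i ≥ 1 : q i < 1/2}` one has `p i = q i₀`
for `1 ≤ i ≤ i₀` and `p i = q i` for `i > i₀`. -/
def IsTruncation (q p : ℕ → ℝ) : Prop :=
  ∃ i0 : ℕ, 1 ≤ i0 ∧ q i0 < 1 / 2 ∧ (∀ i, 1 ≤ i → i < i0 → ¬ q i < 1 / 2) ∧
    (∀ i, 1 ≤ i → i ≤ i0 → p i = q i0) ∧ ∀ i, i0 < i → p i = q i

end NNRW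

open NNRW
/-- `f(N,R,ε) = (1/log 2) (∑_{j=2}^N log_j R + ε log_N R)`; `g(N,R) = f(N,R,0)`. -/
def fNR (N R : ℕ) (ε : ℝ) : ℝ :=
  (1 / Real.log 2) * ((∑ j ∈ Finset.Icc 2 N, iterLog j (R : ℝ)) + ε * iterLog N (R : ℝ))

namespace NNRW

/-! ### Cylinder sets and measurability -/

/-- The cylinder of trajectories which agree with `u` up to time `n`. -/
def cyl (n : ℕ) (u : ℕ → ℕ) : Set (ℕ → ℕ) := {w | ∀ k ≤ n, w k = u k}

/-- The path after time `n`. -/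
def sh (n : ℕ) (w : ℕ → ℕ) : ℕ → ℕ := fun k => w (n + k)

lemma measurable_sh (n : ℕ) : Measurable (sh n) :=
  measurable_pi_lambda _ fun k => measurable_pi_apply (n + k)

lemma sh_apply (n : ℕ) (w : ℕ → ℕ) (k : ℕ) : sh n w k = w (n + k) := rfl

lemma sh_sh (m n : ℕ) (w : ℕ → ℕ) : sh m (sh n w) = sh (n + m) w := by
  funext k; simp [sh, add_assoc]

lemma sh_zero (w : ℕ → ℕ) : sh 0 w = w := by funext k; simp [sh]

lemma measurableSet_coord (k : ℕ) (s : Set ℕ) : MeasurableSet {w : ℕ → ℕ | w k ∈ s} :=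
  measurable_pi_apply k (MeasurableSet.of_discrete (s := s))

lemma measurableSet_cyl (n : ℕ) (u : ℕ → ℕ) : MeasurableSet (cyl n u) := by
  have : cyl n u = ⋂ k, ⋂ (_ : k ≤ n), {w : ℕ → ℕ | w k ∈ ({u k} : Set ℕ)} := by
    ext w; simp [cyl]
  rw [this]
  exact MeasurableSet.iInter fun k => MeasurableSet.iInter fun _ => measurableSet_coord k _

lemma setOf_eq_iUnion_cyl {α : Type*} (f : ℕ → α → ℕ) (n a : ℕ) :
    {x | f n x = a} = ⋃ v : {v : Fin (n + 1) → ℕ // v (Fin.last n) = a},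
      {x | ∀ k ≤ n, f k x = if h : k < n + 1 then v.1 ⟨k, h⟩ else 0} := by
  ext x
  simp only [Set.mem_ofPred_eq, Set.mem_iUnion]
  constructor
  · intro h
    refine ⟨⟨fun k => f k x, by simpa using h⟩, fun k hk => ?_⟩
    simp [Nat.lt_succ_of_le hk]
  · rintro ⟨⟨v, hv⟩, h⟩
    have := h n le_rfl
    simpa [Fin.last, ← hv] using this

lemma measurableSpace_eq_generateFrom_cyl :
    (MeasurableSpace.pi : MeasurableSpace (ℕ → ℕ)) =
      MeasurableSpace.generateFrom {s | ∃ n u, s = cyl n u} := by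
  apply le_antisymm
  · refine iSup_le fun k => ?_
    rw [MeasurableSpace.comap_le_iff_le_map]
    intro s _
    have : (fun w : ℕ → ℕ => w k) ⁻¹' s = ⋃ a ∈ s, {w : ℕ → ℕ | w k = a} := by
      ext w; simp
    change MeasurableSet[MeasurableSpace.generateFrom _] ((fun w : ℕ → ℕ => w k) ⁻¹' s)
    rw [this]
    refine MeasurableSet.biUnion s.to_countable fun a _ => ?_
    rw [setOf_eq_iUnion_cyl (fun k (w : ℕ → ℕ) => w k) k a]
    exact MeasurableSet.iUnion fun v =>
      MeasurableSpace.measurableSet_generateFrom ⟨k, _, rfl⟩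
  · refine MeasurableSpace.generateFrom_le ?_
    rintro s ⟨n, u, rfl⟩
    exact measurableSet_cyl n u

lemma isPiSystem_cyl : IsPiSystem {s : Set (ℕ → ℕ) | ∃ n u, s = cyl n u} := by
  have key : ∀ (n m : ℕ) (u v : ℕ → ℕ), n ≤ m → (cyl n u ∩ cyl m v).Nonempty →
      cyl n u ∩ cyl m v = cyl m v := by
    rintro n m u v hnm ⟨w, hw1, hw2⟩
    refine Set.inter_eq_right.2 fun x hx k hk => ?_
    rw [hx k (hk.trans hnm), ← hw2 k (hk.trans hnm), hw1 k hk]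
  rintro s ⟨n, u, rfl⟩ t ⟨m, v, rfl⟩ hne
  rcases le_total n m with h | h
  · exact ⟨m, v, key n m u v h hne⟩
  · rw [Set.inter_comm] at hne ⊢
    exact ⟨n, u, key m n v u h hne⟩

lemma measure_ext_cyl {μ ν : Measure (ℕ → ℕ)} [IsFiniteMeasure μ]
    (h : ∀ n u, μ (cyl n u) = ν (cyl n u)) (huniv : μ Set.univ = ν Set.univ) : μ = ν := by
  refine ext_of_generate_finite _ measurableSpace_eq_generateFrom_cyl isPiSystem_cyl ?_ huniv
  rintro s ⟨n, u, rfl⟩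
  exact h n u

lemma nullMeasurableSet_of_add_compl_le {Ω : Type*} [MeasurableSpace Ω] {μ : Measure Ω}
    [IsFiniteMeasure μ] {s : Set Ω} (h : μ s + μ sᶜ ≤ μ Set.univ) : NullMeasurableSet s μ := by
  have h1 := measure_union_add_inter (μ := μ) (toMeasurable μ s)
    (measurableSet_toMeasurable μ sᶜ)
  have h2 : toMeasurable μ s ∪ toMeasurable μ sᶜ = Set.univ := by
    rw [Set.eq_univ_iff_forall]
    intro x
    by_cases hx : x ∈ s
    · exact Or.inl (subset_toMeasurable μ s hx)
    · exact Or.inr (subset_toMeasurable μ sᶜ hx)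
  rw [h2, measure_toMeasurable, measure_toMeasurable] at h1
  have h3 : μ (toMeasurable μ s ∩ toMeasurable μ sᶜ) = 0 := by
    have : μ Set.univ + μ (toMeasurable μ s ∩ toMeasurable μ sᶜ) ≤ μ Set.univ + 0 := by
      rw [h1, add_zero]; exact h
    simpa using (ENNReal.add_le_add_iff_left (measure_ne_top μ _)).1 this
  have h4 : s = toMeasurable μ s \ (toMeasurable μ s \ s) := by
    rw [Set.sdiff_sdiff_cancel_left (subset_toMeasurable μ s)]
  rw [h4]
  refine (measurableSet_toMeasurable μ s).nullMeasurableSet.diff (NullMeasurableSet.of_null ?_)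
  have h5 : toMeasurable μ s \ s ⊆ toMeasurable μ s ∩ toMeasurable μ sᶜ :=
    fun x hx => ⟨hx.1, subset_toMeasurable μ sᶜ hx.2⟩
  exact measure_mono_null h5 h3

/-! ### Transition probabilities -/

lemma E_mem {p : ℕ → ℝ} (hp : ∀ i, 1 ≤ i → 0 ≤ p i ∧ p i < 1 / 2) (i : ℕ) :
    1 / 2 ≤ E p i ∧ E p i ≤ 1 := by
  unfold E
  split_ifs with h
  · norm_num
  · have := hp i (by omega)
    constructor <;> linarith

lemma step_nonneg {p : ℕ → ℝ} (hp : ∀ i, 1 ≤ i → 0 ≤ p i ∧ p i < 1 / 2) (i j : ℕ) :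
    0 ≤ step p i j := by
  have := E_mem hp i
  unfold step
  split_ifs <;> linarith

lemma tsum_step {p : ℕ → ℝ} (hp : ∀ i, 1 ≤ i → 0 ≤ p i ∧ p i < 1 / 2) (i : ℕ) :
    ∑' j, ENNReal.ofReal (step p i j) = 1 := by
  have hE := E_mem hp i
  rcases Nat.eq_zero_or_pos i with rfl | hi
  · rw [tsum_eq_single 1]
    · simp [step, E]
    · intro j hj
      simp [step, hj]
  · rw [tsum_eq_sum (s := {i + 1, i - 1})]
    · rw [Finset.sum_pair (by omega)]
      have h1 : step p i (i + 1) = E p i := by simp [step]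
      have h2 : step p i (i - 1) = 1 - E p i := by
        unfold step
        rw [if_neg (by omega), if_pos (by omega)]
      rw [h1, h2, ← ENNReal.ofReal_add (by linarith) (by linarith)]
      simp
    · intro j hj
      simp only [Finset.mem_insert, Finset.mem_singleton, not_or] at hj
      unfold step
      rw [if_neg hj.1, if_neg (by omega)]
      simp

lemma IsNNWalk.nullMeasurableSet_cyl {p : ℕ → ℝ} (hp : ∀ i, 1 ≤ i → 0 ≤ p i ∧ p i < 1 / 2)
    {Ω : Type*} [MeasurableSpace Ω] {P : Measure Ω} [IsProbabilityMeasure P] {X : ℕ → Ω → ℕ}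
    (hX : IsNNWalk P X p 0) (n : ℕ) (u : ℕ → ℕ) :
    NullMeasurableSet {ω | ∀ k ≤ n, X k ω = u k} P := by
  by_cases hu : u 0 = 0
  swap
  · have : {ω | ∀ k ≤ n, X k ω = u k} = ∅ := by
      ext ω
      simp only [Set.mem_ofPred_eq, Set.mem_empty_iff_false, iff_false]
      intro h
      exact hu (by rw [← h 0 (Nat.zero_le _), hX.1])
    rw [this]
    exact nullMeasurableSet_empty
  apply nullMeasurableSet_of_add_compl_le
  rw [measure_univ]
  induction n with
  | zero =>
    have : {ω | ∀ k ≤ 0, X k ω = u k} = Set.univ := by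
      ext ω
      simp [hX.1 ω, hu]
    rw [this]
    simp
  | succ n ih =>
    set C : ℕ → Set Ω := fun a => {ω | (∀ k ≤ n, X k ω = u k) ∧ X (n + 1) ω = a} with hC
    have hCP : ∀ a, P (C a) = P {ω | ∀ k ≤ n, X k ω = u k} *
        ENNReal.ofReal (step p (u n) a) := by
      intro a
      have h1 := hX.2 (n + 1) (fun k => if k ≤ n then u k else a) (by simpa using hu)
      have h2 : {ω | ∀ k ≤ n + 1, X k ω = if k ≤ n then u k else a} = C a := by
        ext ω
        simp only [Set.mem_ofPred_eq, hC]
        constructor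
        · intro h
          exact ⟨fun k hk => by simpa [hk] using h k (by omega), by simpa using h (n + 1) le_rfl⟩
        · rintro ⟨h, h'⟩ k hk
          split_ifs with hkn
          · exact h k hkn
          · rw [show k = n + 1 by omega, h']
      rw [h2, Finset.prod_range_succ, ENNReal.ofReal_mul
        (Finset.prod_nonneg fun _ _ => step_nonneg hp _ _)] at h1
      rw [h1, hX.2 n u hu]
      congr 2
      · refine Finset.prod_congr rfl fun k hk => ?_
        have := Finset.mem_range.1 hk
        rw [if_pos (by omega), if_pos (by omega)]
      · simp
    have h1 : {ω | ∀ k ≤ n + 1, X k ω = u k} = C (u (n + 1)) := by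
      ext ω
      simp only [Set.mem_ofPred_eq, hC]
      constructor
      · intro h
        exact ⟨fun k hk => h k (by omega), h (n + 1) le_rfl⟩
      · rintro ⟨h, h'⟩ k hk
        rcases Nat.le_succ_iff.1 hk with hk | rfl
        · exact h k hk
        · exact h'
    have h2 : {ω | ∀ k ≤ n + 1, X k ω = u k}ᶜ ⊆ {ω | ∀ k ≤ n, X k ω = u k}ᶜ ∪
        ⋃ a : ℕ, (if a = u (n + 1) then ∅ else C a) := by
      intro ω hω
      by_cases h : ω ∈ {ω | ∀ k ≤ n, X k ω = u k}
      · refine Or.inr (Set.mem_iUnion.2 ⟨X (n + 1) ω, ?_⟩)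
        rw [if_neg]
        · exact ⟨h, rfl⟩
        · intro h'
          rw [h1] at hω
          exact hω ⟨h, h'⟩
      · exact Or.inl h
    have h3 : P (⋃ a : ℕ, (if a = u (n + 1) then ∅ else C a)) ≤
        ∑' a, if a = u (n + 1) then 0 else P (C a) := by
      refine (measure_iUnion_le _).trans (ENNReal.tsum_le_tsum fun a => ?_)
      split_ifs <;> simp
    have h4 : P (C (u (n + 1))) + (∑' a, if a = u (n + 1) then 0 else P (C a)) =
        P {ω | ∀ k ≤ n, X k ω = u k} := by
      have h5 : ∑' a, P (C a) = P {ω | ∀ k ≤ n, X k ω = u k} := by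
        simp_rw [hCP]
        rw [ENNReal.tsum_mul_left, tsum_step hp, mul_one]
      rw [← h5, ENNReal.tsum_eq_add_tsum_ite (f := fun a => P (C a)) (u (n + 1))]
      congr 1
      exact tsum_congr fun a => by congr
    have h5 := (measure_mono (μ := P) h2).trans ((measure_union_le _ _).trans
      (add_le_add le_rfl h3))
    calc P {ω | ∀ k ≤ n + 1, X k ω = u k} + P {ω | ∀ k ≤ n + 1, X k ω = u k}ᶜ
        ≤ P (C (u (n + 1))) + (P {ω | ∀ k ≤ n, X k ω = u k}ᶜ +
            ∑' a, if a = u (n + 1) then 0 else P (C a)) :=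
          add_le_add (by rw [h1]) h5
      _ = P {ω | ∀ k ≤ n, X k ω = u k} + P {ω | ∀ k ≤ n, X k ω = u k}ᶜ := by
          rw [← h4, add_right_comm, add_assoc]
      _ ≤ 1 := ih

lemma IsNNWalk.aemeasurable {p : ℕ → ℝ} (hp : ∀ i, 1 ≤ i → 0 ≤ p i ∧ p i < 1 / 2)
    {Ω : Type*} [MeasurableSpace Ω] {P : Measure Ω} [IsProbabilityMeasure P] {X : ℕ → Ω → ℕ}
    (hX : IsNNWalk P X p 0) : AEMeasurable (fun ω k => X k ω) P := by
  refine aemeasurable_pi_iff.2 fun n => NullMeasurable.aemeasurable fun s _ => ?_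
  have : X n ⁻¹' s = ⋃ a ∈ s, {ω | X n ω = a} := by ext; simp
  change NullMeasurableSet (X n ⁻¹' s) P
  rw [this]
  refine NullMeasurableSet.biUnion s.to_countable fun a _ => ?_
  rw [setOf_eq_iUnion_cyl X n a]
  exact NullMeasurableSet.iUnion fun v => hX.nullMeasurableSet_cyl hp n _

/-- A family of laws on the path space, indexed by the starting point, with the one-step Markov
property of the nearest-neighbour walk with parameters `p`. -/
structure IsMarkovFamily (p : ℕ → ℝ) (μ : ℕ → Measure (ℕ → ℕ)) : Prop where
  prob : ∀ x, IsProbabilityMeasure (μ x)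
  start : ∀ x, ∀ᵐ w ∂μ x, w 0 = x
  markov : ∀ x B, MeasurableSet B → μ x (sh 1 ⁻¹' B) =
    ENNReal.ofReal (E p x) * μ (x + 1) B + ENNReal.ofReal (1 - E p x) * μ (x - 1) B

theorem IsNNWalk.exists_isMarkovFamily {p : ℕ → ℝ}
    (hp : ∀ i, 1 ≤ i → 0 ≤ p i ∧ p i < 1 / 2)
    {Ω : Type*} [MeasurableSpace Ω] {P : Measure Ω} [IsProbabilityMeasure P] {X : ℕ → Ω → ℕ}
    (hX : IsNNWalk P X p 0) :
    ∃ μ : ℕ → Measure (ℕ → ℕ), IsMarkovFamily p μ ∧ μ 0 = P.map (fun ω k => X k ω) := by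
  have hXm := hX.aemeasurable hp
  set ν := P.map (fun ω k => X k ω) with hν
  have : IsProbabilityMeasure ν := Measure.isProbabilityMeasure_map hXm
  have hνc : ∀ n u, u 0 = 0 → ν (cyl n u) =
      ENNReal.ofReal (∏ k ∈ Finset.range n, step p (u k) (u (k + 1))) := by
    intro n u hu
    rw [hν, Measure.map_apply_of_aemeasurable hXm (measurableSet_cyl n u)]
    exact hX.2 n u hu
  set c : ℕ → ℝ := fun x => ∏ i ∈ Finset.range x, E p i with hc
  have hc0 : ∀ x, 0 < c x := fun x =>
    Finset.prod_pos fun i _ => by linarith [(E_mem hp i).1]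
  set μ : ℕ → Measure (ℕ → ℕ) := fun x =>
    (ENNReal.ofReal (c x))⁻¹ • (ν.restrict (cyl x id)).map (sh x) with hμ
  have hμa : ∀ x B, MeasurableSet B →
      μ x B = (ENNReal.ofReal (c x))⁻¹ * ν (sh x ⁻¹' B ∩ cyl x id) := by
    intro x B hB
    simp only [hμ, Measure.smul_apply, smul_eq_mul]
    rw [Measure.map_apply (measurable_sh x) hB,
      Measure.restrict_apply (measurable_sh x hB)]
  have hcan : ∀ x, (ENNReal.ofReal (c x))⁻¹ * ENNReal.ofReal (c x) = 1 := fun x =>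
    ENNReal.inv_mul_cancel (by simpa using hc0 x) ENNReal.ofReal_ne_top
  have hνid : ∀ x, ν (cyl x id) = ENNReal.ofReal (c x) := by
    intro x
    rw [hνc x id rfl]
    simp [step, hc]
  have hprob : ∀ x, IsProbabilityMeasure (μ x) := by
    intro x
    refine ⟨?_⟩
    rw [hμa x _ MeasurableSet.univ, Set.preimage_univ, Set.univ_inter, hνid, hcan]
  have hcyl : ∀ x n u, μ x (cyl n u) = if u 0 = x then
      ENNReal.ofReal (∏ k ∈ Finset.range n, step p (u k) (u (k + 1))) else 0 := by
    intro x n u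
    rw [hμa x _ (measurableSet_cyl n u)]
    split_ifs with hu
    · have h1 : sh x ⁻¹' cyl n u ∩ cyl x id =
          cyl (x + n) (fun k => if k ≤ x then k else u (k - x)) := by
        ext w
        simp only [cyl, Set.mem_inter_iff, Set.mem_preimage, Set.mem_ofPred_eq, sh, id]
        constructor
        · rintro ⟨h, h'⟩ k hk
          split_ifs with hkx
          · exact h' k hkx
          · have := h (k - x) (by omega)
            rwa [show x + (k - x) = k by omega] at this
        · intro h
          refine ⟨fun k hk => ?_, fun k hk => ?_⟩
          · have := h (x + k) (by omega)
            rcases Nat.eq_zero_or_pos k with rfl | hk0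
            · simpa [hu] using this
            · rw [if_neg (by omega)] at this
              simpa using this
          · have := h k (by omega)
            rwa [if_pos hk] at this
      rw [h1, hνc _ _ (by simp), Finset.prod_range_add, ENNReal.ofReal_mul
        (Finset.prod_nonneg fun _ _ => step_nonneg hp _ _), ← mul_assoc]
      have h2 : ∏ k ∈ Finset.range x, step p (if k ≤ x then k else u (k - x))
          (if k + 1 ≤ x then k + 1 else u (k + 1 - x)) = c x := by
        refine Finset.prod_congr rfl fun k hk => ?_
        have := Finset.mem_range.1 hk
        rw [if_pos (by omega), if_pos (by omega)]
        simp [step]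
      rw [h2, hcan, one_mul]
      congr 1
      refine Finset.prod_congr rfl fun k hk => ?_
      rw [if_neg (by omega : ¬ x + k + 1 ≤ x), show x + k + 1 - x = k + 1 by omega]
      rcases Nat.eq_zero_or_pos k with rfl | hk0
      · simp [hu]
      · rw [if_neg (by omega), show x + k - x = k by omega]
    · have : sh x ⁻¹' cyl n u ∩ cyl x id = ∅ := by
        ext w
        simp only [cyl, Set.mem_inter_iff, Set.mem_preimage, Set.mem_ofPred_eq, sh, id,
          Set.mem_empty_iff_false, iff_false, not_and]
        intro h h'
        have h1 := h 0 (Nat.zero_le _)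
        have h2 := h' x le_rfl
        simp only [add_zero] at h1
        exact hu (h1.symm.trans h2)
      simp [this]
  have hstart : ∀ x, ∀ᵐ w ∂μ x, w 0 = x := by
    intro x
    have h1 : cyl 0 (fun _ => x) = {w : ℕ → ℕ | w 0 = x} := by ext w; simp [cyl]
    have h2 : μ x (cyl 0 (fun _ => x)) = 1 := by simp [hcyl]
    have := hprob x
    rw [h1] at h2
    exact (prob_compl_eq_zero_iff (measurableSet_coord 0 {x})).2 h2
  refine ⟨μ, ⟨hprob, hstart, ?_⟩, ?_⟩
  · intro x B hB
    have h0 : 0 ≤ 1 - E p x := by linarith [(E_mem hp x).2]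
    have h0' : 0 ≤ E p x := by linarith [(E_mem hp x).1]
    have key : (μ x).map (sh 1) = ENNReal.ofReal (E p x) • μ (x + 1) +
        ENNReal.ofReal (1 - E p x) • μ (x - 1) := by
      have := hprob x
      have : IsProbabilityMeasure ((μ x).map (sh 1)) :=
        Measure.isProbabilityMeasure_map (measurable_sh 1).aemeasurable
      have := hprob (x + 1)
      have := hprob (x - 1)
      refine measure_ext_cyl (fun n u => ?_) ?_
      · rw [Measure.map_apply (measurable_sh 1) (measurableSet_cyl n u)]
        have h1 : μ x (sh 1 ⁻¹' cyl n u) =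
            μ x (cyl (n + 1) (fun k => if k = 0 then x else u (k - 1))) := by
          apply measure_congr
          filter_upwards [hstart x] with w hw
          refine propext ⟨fun h k hk => ?_, fun h k hk => ?_⟩
          · rcases Nat.eq_zero_or_pos k with rfl | hk0
            · simpa using hw
            · have := h (k - 1) (by omega)
              rw [sh_apply, show 1 + (k - 1) = k by omega] at this
              change w k = if k = 0 then x else u (k - 1)
              rw [if_neg (by omega), this]
          · have : w (1 + k) = if 1 + k = 0 then x else u (1 + k - 1) := h (1 + k) (by omega)
            rwa [if_neg (by omega), show 1 + k - 1 = k by omega] at this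
        rw [h1, hcyl, if_pos (by simp), Finset.prod_range_succ']
        simp only [Nat.add_eq_zero_iff, one_ne_zero, and_false, if_false, if_true,
          Nat.add_sub_cancel, Measure.add_apply, Measure.smul_apply, smul_eq_mul, zero_add,
          Nat.sub_self]
        have h2 : ∏ k ∈ Finset.range n, step p (if k + 1 = 0 then x else u k) (u (k + 1)) =
            ∏ k ∈ Finset.range n, step p (u k) (u (k + 1)) := by simp
        rw [hcyl, hcyl, ENNReal.ofReal_mul
          (Finset.prod_nonneg fun _ _ => step_nonneg hp _ _), mul_comm]
        unfold step
        by_cases hux : u 0 = x + 1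
        · rw [if_pos hux, if_pos hux, if_neg (by omega)]
          simp
        · rw [if_neg hux, if_neg hux]
          by_cases hux' : u 0 + 1 = x
          · rw [if_pos hux', if_pos (by omega)]
            simp
          · rw [if_neg hux']
            by_cases hx : x = 0
            · simp [hx, E]
            · rw [if_neg (by omega)]
              simp
      · simp only [measure_univ, Measure.add_apply, Measure.smul_apply, smul_eq_mul, mul_one]
        rw [← ENNReal.ofReal_add h0' h0]
        simp
    rw [← Measure.map_apply (measurable_sh 1) hB, key]
    simp
  · have h1 : ∀ᵐ w ∂ν, w ∈ cyl 0 id := by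
      refine (ae_map_iff hXm (measurableSet_cyl 0 id)).2 ?_
      exact Eventually.of_forall fun ω k hk => by
        rw [Nat.le_zero.1 hk]; exact hX.1 ω
    have h2 : sh 0 = id := funext sh_zero
    simp only [hμ, hc, h2, Measure.map_id, Measure.restrict_eq_self_of_ae_mem h1]
    simp

end NNRW

namespace NNRW

/-! ### Hitting events and the strong Markov property -/

/-- The path is in `Y` at time `n`, has avoided `V` before, and its future after `n` is in `B`. -/
def hitAt (V Y : Set ℕ) (B : Set (ℕ → ℕ)) (n : ℕ) : Set (ℕ → ℕ) :=
  {w | w n ∈ Y ∧ (∀ k < n, w k ∉ V) ∧ sh n w ∈ B}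

/-- The event that `hitAt V Y B n` occurs for some time `n`. -/
def hit (V Y : Set ℕ) (B : Set (ℕ → ℕ)) : Set (ℕ → ℕ) := ⋃ n, hitAt V Y B n

/-- The path climbs straight from `x` to `x + l`, and its future from then on is in `B`. -/
def climb (x l : ℕ) (B : Set (ℕ → ℕ)) : Set (ℕ → ℕ) :=
  {w | (∀ k ≤ l, w k = x + k) ∧ sh l w ∈ B}

/-- The path stays above `m`. -/
def above (m : ℕ) : Set (ℕ → ℕ) := {w | ∀ k, m < w k}

lemma measurableSet_forall_lt (V : Set ℕ) (n : ℕ) :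
    MeasurableSet {w : ℕ → ℕ | ∀ k < n, w k ∉ V} := by
  have : {w : ℕ → ℕ | ∀ k < n, w k ∉ V} = ⋂ k, ⋂ (_ : k < n), {w : ℕ → ℕ | w k ∈ Vᶜ} := by
    ext w; simp
  rw [this]
  exact MeasurableSet.iInter fun k => MeasurableSet.iInter fun _ => measurableSet_coord k _

lemma measurableSet_hitAt (V Y : Set ℕ) {B : Set (ℕ → ℕ)} (hB : MeasurableSet B) (n : ℕ) :
    MeasurableSet (hitAt V Y B n) :=
  (measurableSet_coord n Y).inter ((measurableSet_forall_lt V n).inter (measurable_sh n hB))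

lemma measurableSet_hit (V Y : Set ℕ) {B : Set (ℕ → ℕ)} (hB : MeasurableSet B) :
    MeasurableSet (hit V Y B) :=
  MeasurableSet.iUnion fun n => measurableSet_hitAt V Y hB n

lemma measurableSet_climb (x l : ℕ) {B : Set (ℕ → ℕ)} (hB : MeasurableSet B) :
    MeasurableSet (climb x l B) :=
  (measurableSet_cyl l fun k => x + k).inter (measurable_sh l hB)

lemma measurableSet_above (m : ℕ) : MeasurableSet (above m) := by
  have : above m = ⋂ k, {w : ℕ → ℕ | w k ∈ Set.Ioi m} := by ext w; simp [above]
  rw [this]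
  exact MeasurableSet.iInter fun k => measurableSet_coord k _

lemma mem_hitAt_succ {V Y : Set ℕ} {B : Set (ℕ → ℕ)} {n : ℕ} {w : ℕ → ℕ} :
    w ∈ hitAt V Y B (n + 1) ↔ w 0 ∉ V ∧ sh 1 w ∈ hitAt V Y B n := by
  have h1 : sh n (sh 1 w) = sh (n + 1) w := by rw [sh_sh, add_comm]
  constructor
  · rintro ⟨h, h', h''⟩
    refine ⟨h' 0 (Nat.succ_pos n), ?_, fun k hk => h' (1 + k) (by omega), ?_⟩
    · rw [sh_apply, add_comm]; exact h
    · rw [h1]; exact h''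
  · rintro ⟨h, h', h'', h3⟩
    refine ⟨?_, fun k hk => ?_, ?_⟩
    · rw [sh_apply, add_comm] at h'; exact h'
    · rcases Nat.eq_zero_or_pos k with rfl | hk0
      · exact h
      · have := h'' (k - 1) (by omega)
        rwa [sh_apply, show 1 + (k - 1) = k by omega] at this
    · rw [h1] at h3; exact h3

lemma mem_hit_iff_of_notMem {V Y : Set ℕ} {B : Set (ℕ → ℕ)} {w : ℕ → ℕ} (hYV : Y ⊆ V)
    (hw : w 0 ∉ V) : w ∈ hit V Y B ↔ sh 1 w ∈ hit V Y B := by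
  simp only [hit, Set.mem_iUnion]
  constructor
  · rintro ⟨n, hn⟩
    cases n with
    | zero => exact absurd (hYV hn.1) hw
    | succ n => exact ⟨n, (mem_hitAt_succ.1 hn).2⟩
  · rintro ⟨n, hn⟩
    exact ⟨n + 1, mem_hitAt_succ.2 ⟨hw, hn⟩⟩

lemma mem_climb_succ {x l : ℕ} {B : Set (ℕ → ℕ)} {w : ℕ → ℕ} :
    w ∈ climb x (l + 1) B ↔ w 0 = x ∧ sh 1 w ∈ climb (x + 1) l B := by
  have h1 : sh l (sh 1 w) = sh (l + 1) w := by rw [sh_sh, add_comm]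
  constructor
  · rintro ⟨h, h'⟩
    refine ⟨h 0 (Nat.zero_le _), fun k hk => ?_, ?_⟩
    · rw [sh_apply, h _ (by omega)]; omega
    · rw [h1]; exact h'
  · rintro ⟨h, h', h''⟩
    refine ⟨fun k hk => ?_, ?_⟩
    · rcases Nat.eq_zero_or_pos k with rfl | hk0
      · exact h
      · have := h' (k - 1) (by omega)
        rw [sh_apply, show 1 + (k - 1) = k by omega] at this
        omega
    · rw [h1] at h''; exact h''

namespace IsMarkovFamily

variable {p : ℕ → ℝ} {μ : ℕ → Measure (ℕ → ℕ)}

lemma hitAt_zero_of_mem (h : IsMarkovFamily p μ) {V Y : Set ℕ} {B : Set (ℕ → ℕ)} {x : ℕ}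
    (hx : x ∈ Y) : μ x (hitAt V Y B 0) = μ x B := by
  apply measure_congr
  filter_upwards [h.start x] with w hw
  refine propext ⟨fun h' => ?_, fun h' => ⟨?_, fun k hk => absurd hk (by omega), ?_⟩⟩
  · have := h'.2.2
    rwa [sh_zero] at this
  · rw [hw]; exact hx
  · rw [sh_zero]; exact h'

lemma hitAt_zero_of_notMem (h : IsMarkovFamily p μ) {V Y : Set ℕ} {B : Set (ℕ → ℕ)} {x : ℕ}
    (hx : x ∉ Y) : μ x (hitAt V Y B 0) = 0 := by
  refine measure_mono_null (t := {w | ¬ w 0 = x}) (fun w hw hw' => ?_) (h.start x)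
  exact hx (hw' ▸ hw.1)

lemma hitAt_succ_of_mem (h : IsMarkovFamily p μ) {V Y : Set ℕ} {B : Set (ℕ → ℕ)} {x n : ℕ}
    (hx : x ∈ V) : μ x (hitAt V Y B (n + 1)) = 0 := by
  refine measure_mono_null (t := {w | ¬ w 0 = x}) (fun w hw hw' => ?_) (h.start x)
  exact (mem_hitAt_succ.1 hw).1 (hw'.symm ▸ hx)

lemma hitAt_succ_of_notMem (h : IsMarkovFamily p μ) {V Y : Set ℕ} {B : Set (ℕ → ℕ)}
    (hB : MeasurableSet B) {x n : ℕ} (hx : x ∉ V) :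
    μ x (hitAt V Y B (n + 1)) = ENNReal.ofReal (E p x) * μ (x + 1) (hitAt V Y B n) +
      ENNReal.ofReal (1 - E p x) * μ (x - 1) (hitAt V Y B n) := by
  rw [← h.markov x _ (measurableSet_hitAt V Y hB n)]
  apply measure_congr
  filter_upwards [h.start x] with w hw
  refine propext ⟨fun h' => (mem_hitAt_succ.1 h').2, fun h' => mem_hitAt_succ.2 ⟨?_, h'⟩⟩
  rw [hw]; exact hx

lemma hitAt_mul (h : IsMarkovFamily p μ) {V : Set ℕ} {y : ℕ} {B : Set (ℕ → ℕ)}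
    (hB : MeasurableSet B) (n x : ℕ) :
    μ x (hitAt V {y} B n) = μ x (hitAt V {y} Set.univ n) * μ y B := by
  induction n generalizing x with
  | zero =>
    by_cases hx : x ∈ ({y} : Set ℕ)
    · rw [h.hitAt_zero_of_mem hx, h.hitAt_zero_of_mem hx, Set.mem_singleton_iff.1 hx]
      have := h.prob y
      simp
    · rw [h.hitAt_zero_of_notMem hx, h.hitAt_zero_of_notMem hx, zero_mul]
  | succ n ih =>
    by_cases hx : x ∈ V
    · rw [h.hitAt_succ_of_mem hx, h.hitAt_succ_of_mem hx, zero_mul]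
    · rw [h.hitAt_succ_of_notMem hB hx, h.hitAt_succ_of_notMem MeasurableSet.univ hx, ih, ih,
        add_mul, mul_assoc, mul_assoc]

lemma hit_eq_tsum {V Y : Set ℕ} {B : Set (ℕ → ℕ)} (hYV : Y ⊆ V) (hB : MeasurableSet B)
    (ν : Measure (ℕ → ℕ)) : ν (hit V Y B) = ∑' n, ν (hitAt V Y B n) := by
  refine measure_iUnion (fun i j hij => ?_) fun n => measurableSet_hitAt V Y hB n
  rw [Function.onFun, Set.disjoint_left]
  intro w hi hj
  rcases lt_or_gt_of_ne hij with hlt | hlt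
  · exact hj.2.1 i hlt (hYV hi.1)
  · exact hi.2.1 j hlt (hYV hj.1)

/-- The strong Markov property at the first hitting time of `V`, on the event that this happens
at `y`. -/
lemma hit_mul (h : IsMarkovFamily p μ) {V : Set ℕ} {y : ℕ} (hy : y ∈ V) {B : Set (ℕ → ℕ)}
    (hB : MeasurableSet B) (x : ℕ) :
    μ x (hit V {y} B) = μ x (hit V {y} Set.univ) * μ y B := by
  have hyV : {y} ⊆ V := Set.singleton_subset_iff.2 hy
  rw [hit_eq_tsum hyV hB, hit_eq_tsum hyV MeasurableSet.univ, ← ENNReal.tsum_mul_right]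
  exact tsum_congr fun n => h.hitAt_mul hB n x

lemma hit_le (h : IsMarkovFamily p μ) {V : Set ℕ} {y : ℕ} (hy : y ∈ V) {B : Set (ℕ → ℕ)}
    (hB : MeasurableSet B) (x : ℕ) : μ x (hit V {y} B) ≤ μ y B := by
  have := h.prob x
  rw [h.hit_mul hy hB]
  exact mul_le_of_le_one_left zero_le prob_le_one

lemma hit_of_mem (h : IsMarkovFamily p μ) {V Y : Set ℕ} {x : ℕ} (hx : x ∈ Y) :
    μ x (hit V Y Set.univ) = 1 := by
  have := h.prob x
  refine le_antisymm prob_le_one ?_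
  calc (1 : ℝ≥0∞) = μ x (hitAt V Y Set.univ 0) := by
        rw [h.hitAt_zero_of_mem hx, measure_univ]
    _ ≤ _ := measure_mono (Set.subset_iUnion _ 0)

lemma hit_of_notMem (h : IsMarkovFamily p μ) {V Y : Set ℕ} (hYV : Y ⊆ V) {B : Set (ℕ → ℕ)}
    (hB : MeasurableSet B) {x : ℕ} (hx : x ∉ V) :
    μ x (hit V Y B) = ENNReal.ofReal (E p x) * μ (x + 1) (hit V Y B) +
      ENNReal.ofReal (1 - E p x) * μ (x - 1) (hit V Y B) := by
  rw [← h.markov x _ (measurableSet_hit V Y hB)]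
  apply measure_congr
  filter_upwards [h.start x] with w hw
  exact propext (mem_hit_iff_of_notMem hYV (by rw [hw]; exact hx))

/-- Hitting probabilities are dominated by superharmonic functions. -/
lemma hit_le_of_superharmonic (h : IsMarkovFamily p μ) {V Y : Set ℕ} (g : ℕ → ℝ≥0∞)
    (hgY : ∀ x ∈ Y, 1 ≤ g x)
    (hg : ∀ x ∉ V, ENNReal.ofReal (E p x) * g (x + 1) +
      ENNReal.ofReal (1 - E p x) * g (x - 1) ≤ g x) (hYV : Y ⊆ V) (x : ℕ) :
    μ x (hit V Y Set.univ) ≤ g x := by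
  rw [hit_eq_tsum hYV MeasurableSet.univ]
  have key : ∀ n x, ∑ k ∈ Finset.range n, μ x (hitAt V Y Set.univ k) ≤ g x := by
    intro n
    induction n with
    | zero => simp
    | succ n ih =>
      intro x
      rw [Finset.sum_range_succ']
      by_cases hx : x ∈ V
      · simp only [h.hitAt_succ_of_mem hx, Finset.sum_const_zero, zero_add]
        by_cases hxY : x ∈ Y
        · have := h.prob x
          exact prob_le_one.trans (hgY x hxY)
        · rw [h.hitAt_zero_of_notMem hxY]
          exact zero_le
      · rw [h.hitAt_zero_of_notMem fun hxY => hx (hYV hxY), add_zero]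
        simp only [h.hitAt_succ_of_notMem MeasurableSet.univ hx]
        rw [Finset.sum_add_distrib, ← Finset.mul_sum, ← Finset.mul_sum]
        refine le_trans ?_ (hg x hx)
        gcongr
        · exact ih _
        · exact ih _
  rw [ENNReal.tsum_eq_iSup_nat]
  exact iSup_le fun n => key n x

lemma climb_eq (h : IsMarkovFamily p μ) {B : Set (ℕ → ℕ)} (hB : MeasurableSet B) (l x : ℕ) :
    μ x (climb x l B) =
      (∏ i ∈ Finset.range l, ENNReal.ofReal (E p (x + i))) * μ (x + l) B := by
  induction l generalizing x with
  | zero =>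
    simp only [Finset.range_zero, Finset.prod_empty, one_mul, add_zero]
    apply measure_congr
    filter_upwards [h.start x] with w hw
    refine propext ⟨fun h' => ?_, fun h' => ⟨fun k hk => ?_, ?_⟩⟩
    · have := h'.2
      rwa [sh_zero] at this
    · rw [Nat.le_zero.1 hk]; exact hw
    · rw [sh_zero]; exact h'
  | succ l ih =>
    have h1 : μ x (climb x (l + 1) B) = μ x (sh 1 ⁻¹' climb (x + 1) l B) := by
      apply measure_congr
      filter_upwards [h.start x] with w hw
      exact propext ⟨fun h' => (mem_climb_succ.1 h').2, fun h' => mem_climb_succ.2 ⟨hw, h'⟩⟩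
    have h2 : μ (x - 1) (climb (x + 1) l B) = 0 := by
      refine measure_mono_null (t := {w | ¬ w 0 = x - 1}) (fun w hw hw' => ?_) (h.start (x - 1))
      have h3 : w 0 = x + 1 + 0 := hw.1 0 (Nat.zero_le _)
      have h4 : w 0 = x - 1 := hw'
      omega
    rw [h1, h.markov x _ (measurableSet_climb _ _ hB), h2, ih, Finset.prod_range_succ']
    simp only [mul_zero, add_zero]
    have h3 : ∀ i, x + 1 + i = x + (i + 1) := fun i => by omega
    simp only [h3]
    ring

lemma above_of_le (h : IsMarkovFamily p μ) {m x : ℕ} (hx : x ≤ m) : μ x (above m) = 0 := by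
  refine measure_mono_null (t := {w | ¬ w 0 = x}) (fun w hw hw' => ?_) (h.start x)
  have h3 : m < w 0 := hw 0
  have h4 : w 0 = x := hw'
  omega

lemma above_of_lt (h : IsMarkovFamily p μ) {m x : ℕ} (hx : m < x) :
    μ x (above m) = ENNReal.ofReal (E p x) * μ (x + 1) (above m) +
      ENNReal.ofReal (1 - E p x) * μ (x - 1) (above m) := by
  rw [← h.markov x _ (measurableSet_above m)]
  apply measure_congr
  filter_upwards [h.start x] with w hw
  refine propext ⟨fun h' k => h' (1 + k), fun h' k => ?_⟩
  rcases Nat.eq_zero_or_pos k with rfl | hk0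
  · rw [hw]; exact hx
  · have := h' (k - 1)
    rwa [sh_apply, show 1 + (k - 1) = k by omega] at this

lemma above_eq (h : IsMarkovFamily p μ) (m x : ℕ) :
    μ x (above m) = 1 - μ x (hit (Set.Iic m) (Set.Iic m) Set.univ) := by
  have := h.prob x
  rw [← prob_compl_eq_one_sub (measurableSet_hit _ _ MeasurableSet.univ)]
  congr 1
  ext w
  simp only [above, hit, Set.mem_compl_iff, Set.mem_iUnion, not_exists]
  constructor
  · rintro h' n hn
    exact absurd (h' n) (not_lt.2 hn.1)
  · intro h' k
    by_contra hk
    have hex : ∃ n, w n ≤ m := ⟨k, not_lt.1 hk⟩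
    classical
    exact h' (Nat.find hex) ⟨Nat.find_spec hex, fun j hj => Nat.find_min hex hj, trivial⟩

lemma nearest_neighbour (h : IsMarkovFamily p μ)
    (x : ℕ) : ∀ᵐ w ∂μ x, ∀ n, w (n + 1) = w n + 1 ∨ w (n + 1) + 1 = w n := by
  rw [ae_all_iff]
  intro n
  induction n generalizing x with
  | zero =>
    have h1 : ∀ᵐ w ∂μ x, sh 1 w ∈ {v : ℕ → ℕ | v 0 ∈ {a | a = x + 1 ∨ a + 1 = x}} := by
      have h2 := h.markov x {v : ℕ → ℕ | v 0 ∈ {a | a = x + 1 ∨ a + 1 = x}ᶜ}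
        (measurableSet_coord 0 _)
      have h3 : μ (x + 1) {v : ℕ → ℕ | v 0 ∈ {a | a = x + 1 ∨ a + 1 = x}ᶜ} = 0 := by
        refine measure_mono_null (t := {w | ¬ w 0 = x + 1}) (fun w hw hw' => hw (Or.inl hw'))
          (h.start (x + 1))
      have h4 : ENNReal.ofReal (1 - E p x) *
          μ (x - 1) {v : ℕ → ℕ | v 0 ∈ {a | a = x + 1 ∨ a + 1 = x}ᶜ} = 0 := by
        rcases Nat.eq_zero_or_pos x with rfl | hx
        · simp [E]
        · rw [mul_eq_zero]
          right
          refine measure_mono_null (t := {w | ¬ w 0 = x - 1}) (fun w hw hw' => hw (Or.inr ?_))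
            (h.start (x - 1))
          have : w 0 = x - 1 := hw'
          omega
      rw [h3, h4, mul_zero, add_zero] at h2
      exact h2
    filter_upwards [h1, h.start x] with w hw hw0
    have h5 : w 1 = x + 1 ∨ w 1 + 1 = x := hw
    rw [hw0]
    exact h5
  | succ n ih =>
    set N := {w : ℕ → ℕ | w (n + 1) = w n + 1 ∨ w (n + 1) + 1 = w n}ᶜ with hN
    have hNm : MeasurableSet N := by
      refine MeasurableSet.compl (MeasurableSet.union ?_ ?_)
      · exact measurableSet_eq_fun (measurable_pi_apply _) ((measurable_pi_apply _).add_const 1)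
      · exact measurableSet_eq_fun ((measurable_pi_apply _).add_const 1) (measurable_pi_apply _)
    have h0 : ∀ y, μ y N = 0 := ih
    have h2 := h.markov x N hNm
    rw [h0, h0, mul_zero, mul_zero, add_zero] at h2
    have h3 : ∀ᵐ w ∂μ x, ¬ sh 1 w ∈ N := by
      rw [ae_iff]
      simp only [not_not]
      exact h2
    filter_upwards [h3] with w hw
    simp only [hN, Set.mem_compl_iff, not_not] at hw
    have h4 : w (1 + (n + 1)) = w (1 + n) + 1 ∨ w (1 + (n + 1)) + 1 = w (1 + n) := hw
    rwa [show 1 + (n + 1) = n + 1 + 1 by omega, show 1 + n = n + 1 by omega] at h4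

/-- A function which is harmonic on `(m, n)` has increments with a constant sign pattern: if its
first increment vanishes it is constant. -/
lemma _root_.NNRW.harmonic_const (hp : ∀ i, 1 ≤ i → 0 ≤ p i ∧ p i < 1 / 2) {g : ℕ → ℝ}
    {n : ℕ} (hg : ∀ x < n, g x = E p x * g (x + 1) + (1 - E p x) * g (x - 1)) :
    ∀ x ≤ n, g x = g 0 := by
  intro x
  induction x using Nat.strong_induction_on with
  | _ x ih =>
    intro hx
    rcases Nat.eq_zero_or_pos x with rfl | hx0
    · rfl
    · have h1 := hg (x - 1) (by omega)
      rw [ih (x - 1) (by omega) (by omega), ih (x - 1 - 1) (by omega) (by omega),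
        show x - 1 + 1 = x by omega] at h1
      have h2 := (E_mem hp (x - 1)).1
      have h3 : E p (x - 1) * (g x - g 0) = 0 := by linear_combination -h1
      rcases mul_eq_zero.1 h3 with h4 | h4 <;> linarith

lemma toReal_markov (hp : ∀ i, 1 ≤ i → 0 ≤ p i ∧ p i < 1 / 2) (h : IsMarkovFamily p μ)
    {s : Set (ℕ → ℕ)} {x : ℕ} (hs : μ x s = ENNReal.ofReal (E p x) * μ (x + 1) s +
      ENNReal.ofReal (1 - E p x) * μ (x - 1) s) :
    (μ x).real s = E p x * (μ (x + 1)).real s + (1 - E p x) * (μ (x - 1)).real s := by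
  have := h.prob (x + 1)
  have := h.prob (x - 1)
  have hE := E_mem hp x
  simp only [Measure.real]
  rw [hs, ENNReal.toReal_add (ENNReal.mul_ne_top ENNReal.ofReal_ne_top (measure_ne_top _ _))
    (ENNReal.mul_ne_top ENNReal.ofReal_ne_top (measure_ne_top _ _)), ENNReal.toReal_mul,
    ENNReal.toReal_mul, ENNReal.toReal_ofReal (by linarith), ENNReal.toReal_ofReal (by linarith)]

/-- The walk started at the origin visits every site. -/
lemma hit_Ici (hp : ∀ i, 1 ≤ i → 0 ≤ p i ∧ p i < 1 / 2) (h : IsMarkovFamily p μ) (R : ℕ) :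
    μ 0 (hit (Set.Ici R) {R} Set.univ) = 1 := by
  have := h.prob 0
  have hsub : {R} ⊆ Set.Ici R := Set.singleton_subset_iff.2 Set.self_mem_Ici
  have h1 := harmonic_const hp (g := fun x => (μ x).real (hit (Set.Ici R) {R} Set.univ)) (n := R)
    (fun x hx => h.toReal_markov hp
      (h.hit_of_notMem hsub MeasurableSet.univ (not_le.2 hx))) R le_rfl
  have h2 : (μ R).real (hit (Set.Ici R) {R} Set.univ) = 1 := by
    rw [Measure.real, h.hit_of_mem (Set.mem_singleton R), ENNReal.toReal_one]
  rw [← ENNReal.ofReal_toReal (measure_ne_top (μ 0) _)]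
  have h3 : (μ 0 (hit (Set.Ici R) {R} Set.univ)).toReal = 1 := h1.symm.trans h2
  rw [h3, ENNReal.ofReal_one]

/-- Zero-one law for shift-invariant events. -/
lemma zero_one (hp : ∀ i, 1 ≤ i → 0 ≤ p i ∧ p i < 1 / 2) (h : IsMarkovFamily p μ)
    {T : Set (ℕ → ℕ)} (hT : MeasurableSet T) (hinv : ∀ w, w ∈ T ↔ sh 1 w ∈ T) (x : ℕ) :
    μ x T = 0 ∨ μ x T = 1 := by
  have hpr := h.prob
  have hpre : sh 1 ⁻¹' T = T := by
    ext w; exact (hinv w).symm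
  have hconst : ∀ y, μ y T = μ x T := by
    intro y
    have h1 : ∀ z, (μ z).real T = (μ 0).real T := fun z =>
      harmonic_const hp (g := fun x => (μ x).real T) (n := z)
        (fun x _ => h.toReal_markov hp (by
          conv_lhs => rw [← hpre]
          exact h.markov x T hT)) z le_rfl
    rw [← ENNReal.toReal_eq_toReal_iff' (measure_ne_top _ _) (measure_ne_top _ _)]
    exact (h1 y).trans (h1 x).symm
  have hzero : ∀ n y u, y ≠ u 0 → μ y (cyl n u) = 0 := by
    intro n y u hu
    refine measure_mono_null (t := {w | ¬ w 0 = y}) (fun w hw hw' => hu ?_) (h.start y)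
    exact hw'.symm.trans (hw 0 (Nat.zero_le _))
  have hcyl : ∀ n y u, μ y (cyl n u ∩ T) = μ x T * μ y (cyl n u) := by
    intro n
    induction n with
    | zero =>
      intro y u
      by_cases hu : y = u 0
      · have h1 : μ y (cyl 0 u ∩ T) = μ y T := by
          apply measure_congr
          filter_upwards [h.start y] with w hw
          refine propext ⟨fun h' => h'.2, fun h' => ⟨fun k hk => ?_, h'⟩⟩
          rw [Nat.le_zero.1 hk, hw, hu]
        have h2 : μ y (cyl 0 u) = μ y Set.univ := by
          apply measure_congr
          filter_upwards [h.start y] with w hw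
          refine propext ⟨fun _ => trivial, fun _ k hk => ?_⟩
          rw [Nat.le_zero.1 hk, hw, hu]
        rw [h1, h2, measure_univ, mul_one, hconst]
      · rw [measure_mono_null Set.inter_subset_left (hzero 0 y u hu), hzero 0 y u hu, mul_zero]
    | succ n ih =>
      intro y u
      have hmem : ∀ w, w ∈ cyl (n + 1) u ↔ w 0 = u 0 ∧ sh 1 w ∈ cyl n (sh 1 u) := by
        intro w
        constructor
        · intro hw
          exact ⟨hw 0 (Nat.zero_le _), fun k hk => hw (1 + k) (by omega)⟩
        · rintro ⟨hw, hw'⟩ k hk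
          rcases Nat.eq_zero_or_pos k with rfl | hk0
          · exact hw
          · have := hw' (k - 1) (by omega)
            rwa [sh_apply, sh_apply, show 1 + (k - 1) = k by omega] at this
      by_cases hu : y = u 0
      · have h1 : μ y (cyl (n + 1) u ∩ T) = μ y (sh 1 ⁻¹' (cyl n (sh 1 u) ∩ T)) := by
          apply measure_congr
          filter_upwards [h.start y] with w hw
          exact propext ⟨fun h' => ⟨((hmem w).1 h'.1).2, (hinv w).1 h'.2⟩,
            fun h' => ⟨(hmem w).2 ⟨hw.trans hu, h'.1⟩, (hinv w).2 h'.2⟩⟩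
        have h2 : μ y (cyl (n + 1) u) = μ y (sh 1 ⁻¹' (cyl n (sh 1 u))) := by
          apply measure_congr
          filter_upwards [h.start y] with w hw
          exact propext ⟨fun h' => ((hmem w).1 h').2, fun h' => (hmem w).2 ⟨hw.trans hu, h'⟩⟩
        rw [h1, h2, h.markov y _ ((measurableSet_cyl _ _).inter hT),
          h.markov y _ (measurableSet_cyl _ _), ih, ih]
        ring
      · rw [measure_mono_null Set.inter_subset_left (hzero (n + 1) y u hu),
          hzero (n + 1) y u hu, mul_zero]
  have hmeas : (μ x).restrict T = μ x T • μ x := by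
    refine measure_ext_cyl (fun n u => ?_) ?_
    · rw [Measure.restrict_apply (measurableSet_cyl n u), hcyl]
      simp
    · simp
  have h2 : (μ x).restrict T T = (μ x T • μ x) T := by rw [hmeas]
  rw [Measure.restrict_apply hT, Set.inter_self] at h2
  simp only [Measure.smul_apply, smul_eq_mul] at h2
  by_cases h0 : μ x T = 0
  · exact Or.inl h0
  · right
    have h3 : μ x T * μ x T = μ x T * 1 := by rw [← h2, mul_one]
    exact (ENNReal.mul_right_inj h0 (measure_ne_top _ _)).1 h3

end IsMarkovFamily

end NNRW

namespace NNRW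

/-! ### Escape probabilities for drift `B / (4 i)` -/

/-- The inverse of the probability that the walk with drift `B / (4 i)` started at `x + 1` never
returns to `x`. -/
def lin (B : ℝ) (x : ℕ) : ℝ := (2 * x + B) / (2 * (B - 1))

/-- The probability that the walk with drift `B / (4 i)` started at `n` ever hits `m`. -/
def ret (B : ℝ) (m n : ℕ) : ℝ := ∏ i ∈ Finset.Ico m n, (1 - 1 / lin B i)

lemma lin_pos {B : ℝ} (hB : 1 < B) (x : ℕ) : 0 < lin B x := by
  unfold lin
  have : (0 : ℝ) ≤ x := Nat.cast_nonneg x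
  apply div_pos <;> linarith

lemma lin_mono {B : ℝ} (hB : 1 < B) {x y : ℕ} (h : x ≤ y) : lin B x ≤ lin B y := by
  unfold lin
  have : (x : ℝ) ≤ y := Nat.cast_le.2 h
  apply div_le_div_of_nonneg_right <;> linarith

lemma one_sub_inv_lin {B : ℝ} (hB : 1 < B) (x : ℕ) :
    1 - 1 / lin B x = (2 * x + 2 - B) / (2 * x + B) := by
  unfold lin
  have : (0 : ℝ) ≤ x := Nat.cast_nonneg x
  have h1 : 2 * (x : ℝ) + B ≠ 0 := by linarith
  rw [one_div_div, eq_div_iff h1, sub_mul, div_mul_cancel₀ _ h1]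
  ring

lemma ret_self (B : ℝ) (m : ℕ) : ret B m m = 1 := by simp [ret]

lemma ret_succ (B : ℝ) {m n : ℕ} (h : m ≤ n) :
    ret B m (n + 1) = ret B m n * (1 - 1 / lin B n) := by
  unfold ret
  rw [Finset.prod_Ico_succ_top h]

/-- From `i₁ + 1` on, the walk has drift `B / (4 i)`. -/
def DriftFrom (B : ℝ) (p : ℕ → ℝ) (i₁ : ℕ) : Prop :=
  ∀ i : ℕ, i₁ < i → E p i = 1 / 2 + B / (4 * i) ∧ B < 2 * i

lemma one_sub_inv_lin_nonneg {B : ℝ} (hB : 1 < B) {p : ℕ → ℝ} {i₁ : ℕ} (hE : DriftFrom B p i₁)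
    {i : ℕ} (hi : i₁ ≤ i) : 0 ≤ 1 - 1 / lin B i := by
  rw [one_sub_inv_lin hB]
  have := (hE (i + 1) (by omega)).2
  push_cast at this
  have h1 : (0 : ℝ) ≤ i := Nat.cast_nonneg i
  apply div_nonneg <;> linarith

lemma ret_nonneg {B : ℝ} (hB : 1 < B) {p : ℕ → ℝ} {i₁ : ℕ} (hE : DriftFrom B p i₁)
    {m : ℕ} (hm : i₁ ≤ m) (n : ℕ) : 0 ≤ ret B m n :=
  Finset.prod_nonneg fun _ hi =>
    one_sub_inv_lin_nonneg hB hE (hm.trans (Finset.mem_Ico.1 hi).1)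

lemma ret_harmonic {B : ℝ} (hB : 1 < B) {p : ℕ → ℝ} {i₁ : ℕ} (hE : DriftFrom B p i₁)
    {m x : ℕ} (hm : i₁ ≤ m) (hx : m < x) :
    E p x * ret B m (x + 1) + (1 - E p x) * ret B m (x - 1) = ret B m x := by
  obtain ⟨y, rfl⟩ : ∃ y, x = y + 1 := ⟨x - 1, by omega⟩
  rw [ret_succ B (by omega), ret_succ B (by omega), Nat.add_sub_cancel, one_sub_inv_lin hB,
    one_sub_inv_lin hB, (hE (y + 1) (by omega)).1]
  have h0 : (0 : ℝ) ≤ y := Nat.cast_nonneg y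
  have h1 : 2 * (y : ℝ) + B ≠ 0 := by linarith
  have h2 : 2 * ((y : ℝ) + 1) + B ≠ 0 := by linarith
  have h3 : (y : ℝ) + 1 ≠ 0 := by linarith
  push_cast
  field_simp
  ring

lemma ret_le {B : ℝ} (hB : 1 < B) {p : ℕ → ℝ} {i₁ : ℕ} (hE : DriftFrom B p i₁)
    {m n : ℕ} (hm : i₁ ≤ m) (hn : m < n) :
    1 / (1 - ret B m n) ≤ 1 + lin B n / ((n : ℝ) - m) ∧ 0 < 1 - ret B m n := by
  have hnm : (0 : ℝ) < (n : ℝ) - m := by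
    have : (m : ℝ) < n := Nat.cast_lt.2 hn
    linarith
  have hl := lin_pos hB n
  set σ := ((n : ℝ) - m) / lin B n with hσ
  have hσ0 : 0 < σ := div_pos hnm hl
  have h1 : ret B m n ≤ Real.exp (-σ) := by
    calc ret B m n ≤ ∏ _i ∈ Finset.Ico m n, Real.exp (-(1 / lin B n)) := by
          refine Finset.prod_le_prod (fun i hi => one_sub_inv_lin_nonneg hB hE
            (hm.trans (Finset.mem_Ico.1 hi).1)) fun i hi => ?_
          have h2 := Real.add_one_le_exp (-(1 / lin B n))
          have h3 : 1 / lin B n ≤ 1 / lin B i :=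
            one_div_le_one_div_of_le (lin_pos hB i) (lin_mono hB (Finset.mem_Ico.1 hi).2.le)
          linarith
      _ = Real.exp (-σ) := by
          rw [Finset.prod_const, ← Real.exp_nat_mul, Nat.card_Ico, Nat.cast_sub hn.le, hσ]
          congr 1
          ring
  have h2 : Real.exp (-σ) ≤ 1 / (1 + σ) := by
    rw [Real.exp_neg, ← one_div]
    exact one_div_le_one_div_of_le (by linarith) (by linarith [Real.add_one_le_exp σ])
  have h3 : σ / (1 + σ) ≤ 1 - ret B m n := by
    have : σ / (1 + σ) = 1 - 1 / (1 + σ) := by field_simp; ring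
    linarith
  have h4 : 0 < σ / (1 + σ) := by positivity
  refine ⟨(one_div_le_one_div_of_le h4 h3).trans (le_of_eq ?_), h4.trans_le h3⟩
  rw [hσ]
  field_simp
  ring

namespace IsMarkovFamily

variable {p : ℕ → ℝ} {μ : ℕ → Measure (ℕ → ℕ)}

lemma le_above {B : ℝ} (hB : 1 < B) {i₁ : ℕ} (hE : DriftFrom B p i₁)
    (hp : ∀ i, 1 ≤ i → 0 ≤ p i ∧ p i < 1 / 2) (h : IsMarkovFamily p μ) {m : ℕ} (hm : i₁ ≤ m) :
    1 / lin B m ≤ (μ (m + 1)).real (above m) := by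
  have := h.prob (m + 1)
  have h1 : μ (m + 1) (hit (Set.Iic m) (Set.Iic m) Set.univ) ≤
      ENNReal.ofReal (ret B m (m + 1)) := by
    refine h.hit_le_of_superharmonic (fun x => ENNReal.ofReal (ret B m x)) (fun x hx => ?_)
      (fun x hx => ?_) subset_rfl _
    · have : Finset.Ico m x = ∅ := Finset.Ico_eq_empty_of_le hx
      simp [ret, this]
    · have hx' : m < x := not_le.1 hx
      have hEx := E_mem hp x
      rw [← ENNReal.ofReal_mul (by linarith), ← ENNReal.ofReal_mul (by linarith),
        ← ENNReal.ofReal_add (mul_nonneg (by linarith) (ret_nonneg hB hE hm _))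
          (mul_nonneg (by linarith) (ret_nonneg hB hE hm _)), ret_harmonic hB hE hm hx']
  rw [Measure.real, h.above_eq, ENNReal.toReal_sub_of_le prob_le_one ENNReal.one_ne_top,
    ENNReal.toReal_one]
  have h2 := ENNReal.toReal_le_of_le_ofReal (ret_nonneg hB hE hm _) h1
  rw [ret_succ B le_rfl, ret_self] at h2
  linarith

lemma above_le {B : ℝ} (hB : 1 < B) {i₁ : ℕ} (hE : DriftFrom B p i₁)
    (hp : ∀ i, 1 ≤ i → 0 ≤ p i ∧ p i < 1 / 2) (h : IsMarkovFamily p μ) {m n : ℕ} (hm : i₁ ≤ m)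
    (hn : m < n) :
    (μ (m + 1)).real (above m) ≤ 1 / lin B m * (1 + lin B n / ((n : ℝ) - m)) := by
  have hl := lin_pos hB m
  set g : ℕ → ℝ := fun x => (μ x).real (above m) with hg
  have hgm : g m = 0 := by simp [hg, Measure.real, h.above_of_le le_rfl]
  have key : ∀ k, g (m + k) = g (m + 1) * lin B m * (1 - ret B m (m + k)) := by
    intro k
    induction k using Nat.strong_induction_on with
    | _ k ih =>
      match k, ih with
      | 0, _ => simp [hgm, ret_self]
      | 1, _ =>
        rw [ret_succ B le_rfl, ret_self]
        field_simp
        ring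
      | k + 2, ih =>
        have h1 := h.toReal_markov hp (h.above_of_lt (show m < m + (k + 1) by omega))
        have h2 := ret_harmonic hB hE hm (show m < m + (k + 1) by omega)
        have h3 : g (m + (k + 1)) = E p (m + (k + 1)) * g (m + (k + 2)) +
          (1 - E p (m + (k + 1))) * g (m + k) := h1
        rw [show m + (k + 1) - 1 = m + k by omega, show m + (k + 1) + 1 = m + (k + 2) by omega]
          at h2
        rw [ih (k + 1) (by omega), ih k (by omega)] at h3
        have h4 := (E_mem hp (m + (k + 1))).1
        have h5 : E p (m + (k + 1)) ≠ 0 := by linarith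
        apply mul_left_cancel₀ h5
        linear_combination -h3 + g (m + 1) * lin B m * h2
  obtain ⟨k, rfl⟩ := Nat.exists_eq_add_of_lt hn
  have h1 := key (k + 1)
  obtain ⟨h2, h3⟩ := ret_le hB hE hm hn
  have := h.prob (m + (k + 1))
  have h4 : g (m + (k + 1)) ≤ 1 := measureReal_le_one
  refine le_trans ?_ (mul_le_mul_of_nonneg_left h2 (by positivity))
  change g (m + 1) ≤ _
  rw [one_div_mul_one_div, le_div_iff₀ (by positivity), ← mul_assoc]
  rw [h1] at h4
  exact h4

lemma hit_between_le {B : ℝ} (hB : 1 < B) {i₁ : ℕ} (hE : DriftFrom B p i₁)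
    (hp : ∀ i, 1 ≤ i → 0 ≤ p i ∧ p i < 1 / 2) (h : IsMarkovFamily p μ) {m n : ℕ} (hm : i₁ ≤ m)
    (hn : m < n) :
    (μ (m + 1)).real (hit {x | x ≤ m ∨ n ≤ x} {n} Set.univ) ≤
      1 / lin B m * (1 + lin B n / ((n : ℝ) - m)) := by
  obtain ⟨h2, h3⟩ := ret_le hB hE hm hn
  have hl := lin_pos hB m
  have hle1 : ∀ x, 0 ≤ 1 - ret B m x := fun x => by
    rw [sub_nonneg]
    refine Finset.prod_le_one (fun i hi => one_sub_inv_lin_nonneg hB hE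
      (hm.trans (Finset.mem_Ico.1 hi).1)) fun i _ => ?_
    have := one_div_pos.2 (lin_pos hB i)
    linarith
  have h1 : μ (m + 1) (hit {x | x ≤ m ∨ n ≤ x} {n} Set.univ) ≤
      ENNReal.ofReal ((1 - ret B m (m + 1)) / (1 - ret B m n)) := by
    refine h.hit_le_of_superharmonic
      (fun x => ENNReal.ofReal ((1 - ret B m x) / (1 - ret B m n))) (fun x hx => ?_)
      (fun x hx => ?_) (Set.singleton_subset_iff.2 (Or.inr le_rfl)) _
    · rw [Set.mem_singleton_iff.1 hx, div_self h3.ne', ENNReal.ofReal_one]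
    · have hx' : m < x := by
        by_contra hcon
        exact hx (Or.inl (not_lt.1 hcon))
      have hEx := E_mem hp x
      have hn0 : ∀ y, 0 ≤ (1 - ret B m y) / (1 - ret B m n) := fun y =>
        div_nonneg (hle1 y) h3.le
      rw [← ENNReal.ofReal_mul (by linarith), ← ENNReal.ofReal_mul (by linarith),
        ← ENNReal.ofReal_add (mul_nonneg (by linarith) (hn0 _))
          (mul_nonneg (by linarith) (hn0 _)), ← ret_harmonic hB hE hm hx']
      apply le_of_eq
      congr 1
      ring
  have h4 := ENNReal.toReal_le_of_le_ofReal (div_nonneg (hle1 _) h3.le) h1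
  rw [ret_succ B le_rfl, ret_self, one_mul, sub_sub_cancel, ← mul_one_div] at h4
  exact h4.trans (mul_le_mul_of_nonneg_left h2 (by positivity))

end IsMarkovFamily

end NNRW

namespace NNRW

/-! ### Stretches of sites that are visited exactly once -/

/-- The path climbs straight from `S` to `S + l + 1` and stays above `S + l` afterwards. -/
def run (S l : ℕ) : Set (ℕ → ℕ) := climb S (l + 1) (above (S + l))

/-- After first reaching `R`, the path climbs straight to `R + L R + 1` and stays above
`R + L R` afterwards. -/
def cut (L : ℕ → ℕ) (R : ℕ) : Set (ℕ → ℕ) := hit (Set.Ici R) {R} (run R (L R))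

lemma measurableSet_run (S l : ℕ) : MeasurableSet (run S l) :=
  measurableSet_climb _ _ (measurableSet_above _)

lemma measurableSet_cut (L : ℕ → ℕ) (R : ℕ) : MeasurableSet (cut L R) :=
  measurableSet_hit _ _ (measurableSet_run _ _)

lemma mem_cut {L : ℕ → ℕ} {R : ℕ} {w : ℕ → ℕ} : w ∈ cut L R ↔ ∃ n, (∀ k < n, w k < R) ∧
    (∀ k ≤ L R + 1, w (n + k) = R + k) ∧ ∀ k, R + L R < w (n + (L R + 1) + k) := by
  rw [cut, hit, Set.mem_iUnion]
  refine exists_congr fun n => ⟨fun h => ?_, fun h => ?_⟩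
  · refine ⟨fun k hk => not_le.1 (h.2.1 k hk), h.2.2.1, fun k => ?_⟩
    rw [add_assoc]
    exact h.2.2.2 k
  · refine ⟨h.2.1 0 (Nat.zero_le _), fun k hk => not_le.2 (h.1 k hk), h.2.1, fun k => ?_⟩
    have := h.2.2 k
    rw [add_assoc] at this
    exact this

lemma localTime_eq_one_of_mem_cut {L : ℕ → ℕ} {R j : ℕ} {w : ℕ → ℕ} (hw : w ∈ cut L R)
    (hj : j ≤ L R) : localTime (fun k (w : ℕ → ℕ) => w k) (R + j) w = 1 := by
  obtain ⟨n, h1, h2, h3⟩ := mem_cut.1 hw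
  have hn : w (n + j) = R + j := h2 j (by omega)
  unfold localTime
  rw [tsum_eq_single (n + j)]
  · rw [Set.indicator_of_mem]
    exact hn
  · intro k hk
    rw [Set.indicator_of_notMem]
    intro hk'
    have hk' : w k = R + j := hk'
    rcases lt_or_ge k n with h4 | h4
    · have := h1 k h4
      omega
    obtain ⟨i, rfl⟩ := Nat.exists_eq_add_of_le h4
    rcases lt_or_ge i (L R + 1) with h5 | h5
    · have := h2 i h5.le
      omega
    · obtain ⟨i, rfl⟩ := Nat.exists_eq_add_of_le h5
      have := h3 i
      rw [← add_assoc] at hk'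
      omega

lemma eq_of_localTime_le_one {S a b : ℕ} {w : ℕ → ℕ}
    (h : localTime (fun k (w : ℕ → ℕ) => w k) S w ≤ 1) (ha : w a = S) (hb : w b = S) :
    a = b := by
  by_contra hab
  have h1 := (ENNReal.sum_le_tsum (f := fun k : ℕ =>
    Set.indicator {k | w k = S} (fun _ => (1 : ℝ≥0∞)) k) {a, b}).trans h
  rw [Finset.sum_pair hab, Set.indicator_of_mem (by exact ha), Set.indicator_of_mem (by exact hb)]
    at h1
  norm_num at h1

lemma exists_eq_of_nearest_neighbour {w : ℕ → ℕ}
    (hw : ∀ n, w (n + 1) = w n + 1 ∨ w (n + 1) + 1 = w n) {S a b : ℕ} (ha : w a ≤ S)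
    (hb : S ≤ w b) (hab : a ≤ b) : ∃ c, a ≤ c ∧ w c = S := by
  induction b, hab using Nat.le_induction with
  | base => exact ⟨a, le_rfl, le_antisymm ha hb⟩
  | succ b hab ih =>
    rcases le_or_gt S (w b) with h | h
    · exact ih h
    · refine ⟨b + 1, by omega, ?_⟩
      rcases hw b with h' | h' <;> omega

lemma mem_cut_of_localTime_le_one {w : ℕ → ℕ} (h0 : w 0 = 0)
    (hw : ∀ n, w (n + 1) = w n + 1 ∨ w (n + 1) + 1 = w n)
    (hhit : ∀ x, w ∈ hit (Set.Ici x) {x} Set.univ) {L : ℕ → ℕ} {R : ℕ}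
    (hl : ∀ j ≤ L R, localTime (fun k (w : ℕ → ℕ) => w k) (R + j) w ≤ 1) : w ∈ cut L R := by
  have hle : ∀ k, w k ≤ k := by
    intro k
    induction k with
    | zero => exact h0.le
    | succ k ih => rcases hw k with h | h <;> omega
  have habove : ∀ j ≤ L R, ∀ a, w a = R + j → ∀ k, a < k → R + j < w k := by
    intro j hj a ha k hk
    by_contra hcon
    obtain ⟨n, hn⟩ := Set.mem_iUnion.1 (hhit (k + R + j))
    have h1 : w n = k + R + j := hn.1
    have h2 := hle n
    obtain ⟨c, hc, hc'⟩ := exists_eq_of_nearest_neighbour hw (not_lt.1 hcon)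
      (show R + j ≤ w n by omega) (by omega)
    have := eq_of_localTime_le_one (hl j hj) ha hc'
    omega
  obtain ⟨n, hn⟩ := Set.mem_iUnion.1 (hhit R)
  have hn0 : w n = R := hn.1
  have hclimb : ∀ k ≤ L R + 1, w (n + k) = R + k := by
    intro k
    induction k with
    | zero => exact fun _ => hn0
    | succ k ih =>
      intro hk
      have h1 := ih (by omega)
      have h2 := habove k (by omega) _ h1 (n + (k + 1)) (by omega)
      rcases hw (n + k) with h | h <;> rw [← add_assoc] at * <;> omega
  refine mem_cut.2 ⟨n, fun k hk => not_le.1 (hn.2.1 k hk), hclimb, fun k => ?_⟩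
  exact habove (L R) le_rfl _ (hclimb _ (Nat.le_succ _)) _ (by omega)

lemma cut_inter_subset_of_le {L : ℕ → ℕ} {R S : ℕ} (hRS : R < S) (hS : S ≤ R + L R) :
    cut L R ∩ cut L S ⊆ hit (Set.Ici R) {R} (climb R (S - R) (run S (L S))) := by
  rintro w ⟨hR, hS'⟩
  obtain ⟨n, h1, h2, h3⟩ := mem_cut.1 hR
  obtain ⟨n', hn'⟩ := Set.mem_iUnion.1 hS'
  have hS0 : w n' = S := hn'.1
  have e1 : w (n + (S - R)) = S := by
    rw [h2 _ (by omega)]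
    omega
  have e2 : n' = n + (S - R) := by
    rcases lt_trichotomy n' (n + (S - R)) with h | h | h
    · exfalso
      rcases lt_or_ge n' n with h4 | h4
      · have := h1 _ h4
        omega
      · obtain ⟨i, rfl⟩ := Nat.exists_eq_add_of_le h4
        have := h2 i (by omega)
        omega
    · exact h
    · exact absurd (show S ≤ w (n + (S - R)) from e1.ge) (hn'.2.1 _ h)
  refine Set.mem_iUnion.2 ⟨n, h2 0 (Nat.zero_le _), fun k hk => not_le.2 (h1 k hk),
    fun k hk => h2 k (by omega), ?_⟩
  rw [sh_sh, ← e2]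
  exact hn'.2.2

lemma cut_inter_subset_of_lt {L : ℕ → ℕ} {R S : ℕ} (hS : R + L R < S) :
    cut L R ∩ cut L S ⊆ hit (Set.Ici R) {R} (climb R (L R + 1)
      (hit {x | x ≤ R + L R ∨ S ≤ x} {S} (run S (L S)))) := by
  rintro w ⟨hR, hS'⟩
  obtain ⟨n, h1, h2, h3⟩ := mem_cut.1 hR
  obtain ⟨n', hn'⟩ := Set.mem_iUnion.1 hS'
  have hS0 : w n' = S := hn'.1
  have e1 : n + (L R + 1) ≤ n' := by
    by_contra hcon
    rcases lt_or_ge n' n with h4 | h4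
    · have := h1 _ h4
      omega
    · obtain ⟨i, rfl⟩ := Nat.exists_eq_add_of_le h4
      have := h2 i (by omega)
      omega
  obtain ⟨i, rfl⟩ := Nat.exists_eq_add_of_le e1
  refine Set.mem_iUnion.2 ⟨n, h2 0 (Nat.zero_le _), fun k hk => not_le.2 (h1 k hk), h2, ?_⟩
  rw [sh_sh]
  refine Set.mem_iUnion.2 ⟨i, hS0, fun k hk => ?_, ?_⟩
  · rintro (h | h)
    · exact absurd (h3 k) (not_lt.2 h)
    · exact hn'.2.1 (n + (L R + 1) + k) (by omega) h
  · rw [sh_sh]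
    exact hn'.2.2

namespace IsMarkovFamily

variable {p : ℕ → ℝ} {μ : ℕ → Measure (ℕ → ℕ)}

lemma toReal_prod (hp : ∀ i, 1 ≤ i → 0 ≤ p i ∧ p i < 1 / 2) (x l : ℕ) :
    (∏ i ∈ Finset.range l, ENNReal.ofReal (E p (x + i))).toReal =
      ∏ i ∈ Finset.range l, E p (x + i) := by
  rw [ENNReal.toReal_prod]
  exact Finset.prod_congr rfl fun i _ => ENNReal.toReal_ofReal (by linarith [(E_mem hp (x + i)).1])

lemma cut_eq (hp : ∀ i, 1 ≤ i → 0 ≤ p i ∧ p i < 1 / 2) (h : IsMarkovFamily p μ) (L : ℕ → ℕ)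
    (R : ℕ) : μ 0 (cut L R) = μ R (run R (L R)) := by
  rw [cut, h.hit_mul Set.self_mem_Ici (measurableSet_run _ _), h.hit_Ici hp, one_mul]

lemma cut_real (hp : ∀ i, 1 ≤ i → 0 ≤ p i ∧ p i < 1 / 2) (h : IsMarkovFamily p μ) (L : ℕ → ℕ)
    (R : ℕ) : (μ 0).real (cut L R) = (∏ i ∈ Finset.range (L R + 1), E p (R + i)) *
      (μ (R + L R + 1)).real (above (R + L R)) := by
  rw [Measure.real, h.cut_eq hp, run, h.climb_eq (measurableSet_above _), ENNReal.toReal_mul,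
    toReal_prod hp, add_assoc R]
  rfl

lemma cut_inter_near (hp : ∀ i, 1 ≤ i → 0 ≤ p i ∧ p i < 1 / 2) (h : IsMarkovFamily p μ)
    {L : ℕ → ℕ} {R S : ℕ} (hRS : R < S) (hS : S ≤ R + L R) :
    (μ 0).real (cut L R ∩ cut L S) ≤
      (∏ i ∈ Finset.range (S - R), E p (R + i)) * (μ 0).real (cut L S) := by
  have h0 := h.prob R
  have h1 : μ 0 (cut L R ∩ cut L S) ≤ μ R (climb R (S - R) (run S (L S))) :=
    (measure_mono (cut_inter_subset_of_le hRS hS)).trans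
      (h.hit_le Set.self_mem_Ici (measurableSet_climb _ _ (measurableSet_run _ _)) 0)
  refine (ENNReal.toReal_mono (measure_ne_top _ _) h1).trans (le_of_eq ?_)
  rw [h.climb_eq (measurableSet_run _ _), ENNReal.toReal_mul, toReal_prod hp,
    Nat.add_sub_cancel' hRS.le, ← h.cut_eq hp]
  rfl

lemma cut_inter_far {B : ℝ} (hB : 1 < B) {i₁ : ℕ} (hE : DriftFrom B p i₁)
    (hp : ∀ i, 1 ≤ i → 0 ≤ p i ∧ p i < 1 / 2) (h : IsMarkovFamily p μ)
    {L : ℕ → ℕ} {R S : ℕ} (hR : i₁ ≤ R) (hS : R + L R < S) :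
    (μ 0).real (cut L R ∩ cut L S) ≤ (μ 0).real (cut L R) * (μ 0).real (cut L S) *
      (1 + lin B S / ((S : ℝ) - (R + L R : ℕ))) := by
  have h0 := h.prob R
  have h0' := h.prob (R + L R + 1)
  have hmem : S ∈ {x | x ≤ R + L R ∨ S ≤ x} := Or.inr le_rfl
  have h1 : μ 0 (cut L R ∩ cut L S) ≤ μ R (climb R (L R + 1)
      (hit {x | x ≤ R + L R ∨ S ≤ x} {S} (run S (L S)))) :=
    (measure_mono (cut_inter_subset_of_lt hS)).trans
      (h.hit_le Set.self_mem_Ici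
        (measurableSet_climb _ _ (measurableSet_hit _ _ (measurableSet_run _ _))) 0)
  refine (ENNReal.toReal_mono (measure_ne_top _ _) h1).trans ?_
  rw [h.climb_eq (measurableSet_hit _ _ (measurableSet_run _ _)), ENNReal.toReal_mul,
    toReal_prod hp, h.hit_mul hmem (measurableSet_run _ _), ENNReal.toReal_mul, ← h.cut_eq hp,
    h.cut_real hp L R, ← add_assoc]
  set π := ∏ i ∈ Finset.range (L R + 1), E p (R + i)
  have hπ : 0 ≤ π := Finset.prod_nonneg fun i _ => by linarith [(E_mem hp (R + i)).1]
  have h2 := h.hit_between_le hB hE hp (hR.trans (Nat.le_add_right R (L R))) hS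
  have h3 := h.le_above hB hE hp (hR.trans (Nat.le_add_right R (L R)))
  have h4 : 0 ≤ 1 + lin B S / ((S : ℝ) - (R + L R : ℕ)) := by
    have : ((R + L R : ℕ) : ℝ) < S := Nat.cast_lt.2 hS
    have := div_nonneg (lin_pos hB S).le (sub_nonneg.2 this.le)
    linarith
  have h5 := h2.trans (mul_le_mul_of_nonneg_right h3 h4)
  calc π * (((μ (R + L R + 1)) (hit {x | x ≤ R + L R ∨ S ≤ x} {S} Set.univ)).toReal *
        (μ 0 (cut L S)).toReal)
      ≤ π * (((μ (R + L R + 1)).real (above (R + L R)) *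
        (1 + lin B S / ((S : ℝ) - (R + L R : ℕ)))) * (μ 0 (cut L S)).toReal) := by
        gcongr
        exact h5
    _ = _ := by
        rw [Measure.real, Measure.real]
        ring

lemma limsup_cut_zero_one (hp : ∀ i, 1 ≤ i → 0 ≤ p i ∧ p i < 1 / 2) (h : IsMarkovFamily p μ)
    (L : ℕ → ℕ) (x : ℕ) :
    μ x (limsup (cut L) atTop) = 0 ∨ μ x (limsup (cut L) atTop) = 1 := by
  refine h.zero_one hp (MeasurableSet.measurableSet_limsup fun R => measurableSet_cut L R)
    (fun w => ?_) x
  rw [mem_limsup_iff_frequently_mem, mem_limsup_iff_frequently_mem]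
  refine frequently_congr ?_
  filter_upwards [eventually_gt_atTop (w 0)] with R hR
  exact mem_hit_iff_of_notMem (Set.singleton_subset_iff.2 Set.self_mem_Ici) (not_le.2 hR)

end IsMarkovFamily

end NNRW

namespace NNRW

/-! ### A second moment criterion -/

section SecondMoment

variable {α : Type*} [MeasurableSpace α] {P : Measure α} [IsProbabilityMeasure P] {A : ℕ → Set α}

lemma second_moment_le (hA : ∀ R, MeasurableSet (A R)) (I : Finset ℕ) (t : ℝ) :
    2 * t * ∑ R ∈ I, P.real (A R) - t ^ 2 * ∑ R ∈ I, ∑ S ∈ I, P.real (A R ∩ A S) ≤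
      P.real (⋃ R ∈ I, A R) := by
  have hU : MeasurableSet (⋃ R ∈ I, A R) := I.measurableSet_biUnion fun R _ => hA R
  have hint : ∀ {s : Set α}, MeasurableSet s → Integrable (s.indicator (1 : α → ℝ)) P :=
    fun hs => (integrable_const (1 : ℝ)).indicator hs
  have h1 : ∫ x, (∑ R ∈ I, (A R).indicator (1 : α → ℝ) x) ∂P = ∑ R ∈ I, P.real (A R) := by
    rw [integral_finsetSum _ fun R _ => hint (hA R)]
    exact Finset.sum_congr rfl fun R _ => integral_indicator_one (hA R)
  have h2 : ∫ x, (∑ R ∈ I, ∑ S ∈ I, (A R ∩ A S).indicator (1 : α → ℝ) x) ∂P =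
      ∑ R ∈ I, ∑ S ∈ I, P.real (A R ∩ A S) := by
    rw [integral_finsetSum _ fun R _ =>
      integrable_finsetSum _ fun S _ => hint ((hA R).inter (hA S))]
    refine Finset.sum_congr rfl fun R _ => ?_
    rw [integral_finsetSum _ fun S _ => hint ((hA R).inter (hA S))]
    exact Finset.sum_congr rfl fun S _ => integral_indicator_one ((hA R).inter (hA S))
  rw [← h1, ← h2, ← integral_indicator_one hU, ← integral_const_mul, ← integral_const_mul,
    ← integral_sub]
  · refine integral_mono ?_ (hint hU) fun x => ?_
    · exact ((integrable_finsetSum _ fun R _ => hint (hA R)).const_mul _).sub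
        ((integrable_finsetSum _ fun R _ =>
          integrable_finsetSum _ fun S _ => hint ((hA R).inter (hA S))).const_mul _)
    · have h3 : ∑ R ∈ I, ∑ S ∈ I, (A R ∩ A S).indicator (1 : α → ℝ) x =
          (∑ R ∈ I, (A R).indicator (1 : α → ℝ) x) ^ 2 := by
        rw [sq, Finset.sum_mul_sum]
        simp only [Set.inter_indicator_one, Pi.mul_apply]
      beta_reduce
      rw [h3]
      by_cases hx : x ∈ ⋃ R ∈ I, A R
      · rw [Set.indicator_of_mem hx]
        have := sq_nonneg (1 - t * ∑ R ∈ I, (A R).indicator (1 : α → ℝ) x)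
        simp only [Pi.one_apply]
        linarith
      · rw [Set.indicator_of_notMem hx, Finset.sum_eq_zero]
        · simp
        · intro R hR
          exact Set.indicator_of_notMem (fun h => hx (Set.mem_biUnion hR h)) _
  · exact (integrable_finsetSum _ fun R _ => hint (hA R)).const_mul _
  · exact (integrable_finsetSum _ fun R _ =>
      integrable_finsetSum _ fun S _ => hint ((hA R).inter (hA S))).const_mul _

lemma measure_limsup_ne_zero (hA : ∀ R, MeasurableSet (A R))
    (hs : ¬ Summable fun R => P.real (A R)) {C : ℝ} (hC0 : 0 < C) {M₀ : ℕ}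
    (hC : ∀ M, M₀ ≤ M → ∀ n, ∑ R ∈ Finset.Ico M n, ∑ S ∈ Finset.Ico M n, P.real (A R ∩ A S) ≤
      C * ((∑ R ∈ Finset.Ico M n, P.real (A R)) ^ 2 + ∑ R ∈ Finset.Ico M n, P.real (A R))) :
    P (limsup A atTop) ≠ 0 := by
  have hle : ∀ M, M₀ ≤ M → 1 / (2 * C) ≤ P.real (⋃ R ≥ M, A R) := by
    intro M hM
    obtain ⟨n, hn⟩ : ∃ n, 1 ≤ ∑ R ∈ Finset.Ico M n, P.real (A R) := by
      have hs' : ¬ Summable fun R => P.real (A (R + M)) := fun h =>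
        hs ((summable_nat_add_iff (f := fun R => P.real (A R)) M).1 h)
      have h1 := (not_summable_iff_tendsto_nat_atTop_of_nonneg
        fun R => measureReal_nonneg).1 hs'
      obtain ⟨k, hk⟩ := (h1.eventually_ge_atTop 1).exists
      refine ⟨M + k, ?_⟩
      rw [Finset.sum_Ico_eq_sum_range, Nat.add_sub_cancel_left]
      simpa only [add_comm] using hk
    set s := ∑ R ∈ Finset.Ico M n, P.real (A R) with hs_def
    have h2 := second_moment_le (P := P) hA (Finset.Ico M n) (1 / (2 * C * s))
    have h3 := hC M hM n
    rw [← hs_def] at h2 h3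
    have hs0 : 0 < s := by linarith
    have h4 : (1 / (2 * C * s)) ^ 2 * ∑ R ∈ Finset.Ico M n, ∑ S ∈ Finset.Ico M n,
        P.real (A R ∩ A S) ≤ (1 / (2 * C * s)) ^ 2 * (C * (s ^ 2 + s ^ 2)) := by
      refine mul_le_mul_of_nonneg_left (h3.trans ?_) (by positivity)
      gcongr
      nlinarith
    have h5 : 2 * (1 / (2 * C * s)) * s - (1 / (2 * C * s)) ^ 2 * (C * (s ^ 2 + s ^ 2)) =
        1 / (2 * C) := by
      field_simp
      ring
    have h6 : P.real (⋃ R ∈ Finset.Ico M n, A R) ≤ P.real (⋃ R ≥ M, A R) := by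
      refine measureReal_mono (Set.iUnion₂_subset fun R hR => ?_) (measure_ne_top _ _)
      exact Set.subset_biUnion_of_mem (u := A) (show R ∈ {R | R ≥ M} from (Finset.mem_Ico.1 hR).1)
    linarith
  have htend : Tendsto (fun M => P (⋃ R ≥ M, A R)) atTop (𝓝 (P (⋂ M, ⋃ R ≥ M, A R))) := by
    refine tendsto_measure_iInter_atTop (fun M => ?_) (fun a b hab => ?_) ⟨0, measure_ne_top _ _⟩
    · exact (MeasurableSet.iUnion fun R => MeasurableSet.iUnion fun _ => hA R).nullMeasurableSet
    · exact Set.iUnion₂_subset fun R hR =>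
        Set.subset_biUnion_of_mem (u := A) (show R ∈ {R | R ≥ a} from hab.trans hR)
  have h1 : ENNReal.ofReal (1 / (2 * C)) ≤ P (⋂ M, ⋃ R ≥ M, A R) := by
    refine ge_of_tendsto htend ?_
    filter_upwards [eventually_ge_atTop M₀] with M hM
    exact ENNReal.ofReal_le_of_le_toReal (hle M hM)
  have h2 : limsup A atTop = ⋂ M, ⋃ R ≥ M, A R := limsup_eq_iInf_iSup_of_nat
  rw [h2]
  exact ((ENNReal.ofReal_pos.2 (by positivity)).trans_le h1).ne'

lemma sum_pow_sub_le {r : ℝ} (hr0 : 0 ≤ r) (hr : r < 1) (I : Finset ℕ) (S : ℕ) :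
    ∑ R ∈ I, (if R ≤ S then r ^ (S - R) else 0) ≤ (1 - r)⁻¹ := by
  rw [← Finset.sum_filter]
  calc ∑ R ∈ I with R ≤ S, r ^ (S - R) ≤ ∑ R ∈ Finset.range (S + 1), r ^ (S - R) := by
        refine Finset.sum_le_sum_of_subset_of_nonneg (fun R hR => ?_) fun R _ _ => by positivity
        rw [Finset.mem_range]
        have := (Finset.mem_filter.1 hR).2
        omega
    _ = ∑ j ∈ Finset.range (S + 1), r ^ j := Finset.sum_flip fun j => r ^ j
    _ ≤ ∑' j, r ^ j := (summable_geometric_of_lt_one hr0 hr).sum_le_tsum _ fun j _ => by positivity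
    _ = (1 - r)⁻¹ := tsum_geometric_of_lt_one hr0 hr

/-- A sequence of events with divergent sum of probabilities which is quasi-independent up to
summable corrections occurs infinitely often with positive probability. -/
lemma measure_limsup_ne_zero_of_pair_le (hA : ∀ R, MeasurableSet (A R))
    (hs : ¬ Summable fun R => P.real (A R)) {r K D : ℝ} (hr0 : 0 ≤ r) (hr : r < 1) (hK : 0 ≤ K)
    (hD : 0 ≤ D) {c : ℕ → ℕ → ℝ} (hc : ∀ R S, 0 ≤ c R S) {M₀ : ℕ}
    (hcK : ∀ M, M₀ ≤ M → ∀ R, M ≤ R → ∀ n, ∑ S ∈ Finset.Ico M n, c R S ≤ K)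
    (hpair : ∀ R, M₀ ≤ R → ∀ S, R ≤ S → P.real (A R ∩ A S) ≤
      r ^ (S - R) * P.real (A S) + D * (P.real (A R) * P.real (A S)) + P.real (A R) * c R S) :
    P (limsup A atTop) ≠ 0 := by
  have hr1 : 0 < (1 - r)⁻¹ := inv_pos.2 (by linarith)
  refine measure_limsup_ne_zero hA hs (C := 2 * ((1 - r)⁻¹ + D + K)) (by positivity) (M₀ := M₀)
    fun M hM n => ?_
  set I := Finset.Ico M n
  set a : ℕ → ℝ := fun R => P.real (A R)
  have ha : ∀ R, 0 ≤ a R := fun R => measureReal_nonneg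
  set g : ℕ → ℕ → ℝ := fun R S =>
    (if R ≤ S then r ^ (S - R) else 0) * a S + D * (a R * a S) + a R * c R S
  have hg : ∀ R S, 0 ≤ g R S := by
    intro R S
    have h1 : 0 ≤ (if R ≤ S then r ^ (S - R) else 0) := by split_ifs <;> positivity
    have h2 := mul_nonneg h1 (ha S)
    have h3 := mul_nonneg hD (mul_nonneg (ha R) (ha S))
    have h4 := mul_nonneg (ha R) (hc R S)
    simp only [g]
    linarith
  have hle : ∀ R ∈ I, ∀ S ∈ I, P.real (A R ∩ A S) ≤ g R S + g S R := by
    intro R hR S hS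
    rcases le_total R S with h | h
    · have := hpair R (hM.trans (Finset.mem_Ico.1 hR).1) S h
      have h' := hg S R
      have h'' : g R S = r ^ (S - R) * a S + D * (a R * a S) + a R * c R S := by
        simp only [g, if_pos h]
      linarith
    · have := hpair S (hM.trans (Finset.mem_Ico.1 hS).1) R h
      rw [Set.inter_comm] at this
      have h' := hg R S
      have h'' : g S R = r ^ (R - S) * a R + D * (a S * a R) + a S * c S R := by
        simp only [g, if_pos h]
      linarith
  have hsum : ∑ R ∈ I, ∑ S ∈ I, g R S ≤
      (1 - r)⁻¹ * (∑ R ∈ I, a R) + D * (∑ R ∈ I, a R) ^ 2 + K * ∑ R ∈ I, a R := by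
    simp only [g, Finset.sum_add_distrib]
    have h1 : ∑ R ∈ I, ∑ S ∈ I, (if R ≤ S then r ^ (S - R) else 0) * a S ≤
        (1 - r)⁻¹ * ∑ R ∈ I, a R := by
      rw [Finset.sum_comm, Finset.mul_sum]
      refine Finset.sum_le_sum fun S _ => ?_
      rw [← Finset.sum_mul]
      exact mul_le_mul_of_nonneg_right (sum_pow_sub_le hr0 hr I S) (ha S)
    have h2 : ∑ R ∈ I, ∑ S ∈ I, D * (a R * a S) = D * (∑ R ∈ I, a R) ^ 2 := by
      rw [sq, Finset.sum_mul_sum, Finset.mul_sum]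
      exact Finset.sum_congr rfl fun R _ => by rw [Finset.mul_sum]
    have h3 : ∑ R ∈ I, ∑ S ∈ I, a R * c R S ≤ K * ∑ R ∈ I, a R := by
      rw [Finset.mul_sum]
      refine Finset.sum_le_sum fun R hR => ?_
      rw [← Finset.mul_sum, mul_comm]
      exact mul_le_mul_of_nonneg_right (hcK M hM R (Finset.mem_Ico.1 hR).1 n) (ha R)
    linarith
  have hs0 : 0 ≤ ∑ R ∈ I, a R := Finset.sum_nonneg fun R _ => ha R
  calc ∑ R ∈ I, ∑ S ∈ I, P.real (A R ∩ A S) ≤ ∑ R ∈ I, ∑ S ∈ I, (g R S + g S R) :=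
        Finset.sum_le_sum fun R hR => Finset.sum_le_sum fun S hS => hle R hR S hS
    _ = ∑ R ∈ I, ∑ S ∈ I, g R S + ∑ R ∈ I, ∑ S ∈ I, g R S := by
        simp only [Finset.sum_add_distrib]
        congr 1
        exact Finset.sum_comm
    _ ≤ _ := by nlinarith [mul_nonneg hr1.le (sq_nonneg (∑ R ∈ I, a R)), mul_nonneg hD hs0,
        mul_nonneg hK (sq_nonneg (∑ R ∈ I, a R))]

end SecondMoment

lemma sum_div_mul_add_eq (m K : ℕ) :
    ∑ k ∈ Finset.range K, (m : ℝ) / (((k : ℝ) + 1) * (m + k + 1)) =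
      (harmonic K : ℝ) + harmonic m - harmonic (m + K) := by
  induction K with
  | zero => simp
  | succ K ih =>
    rw [Finset.sum_range_succ, ih, harmonic_succ, ← add_assoc, harmonic_succ]
    push_cast
    have h1 : (K : ℝ) + 1 ≠ 0 := by positivity
    have h2 : (m : ℝ) + K + 1 ≠ 0 := by positivity
    field_simp
    ring

lemma sum_div_sub_mul_le (M n m : ℕ) :
    ∑ S ∈ Finset.Ico M n, (if m < S then (m : ℝ) / (((S : ℝ) - m) * S) else 0) ≤
      1 + Real.log m := by
  rw [← Finset.sum_filter]
  calc ∑ S ∈ Finset.Ico M n with m < S, (m : ℝ) / (((S : ℝ) - m) * S)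
      ≤ ∑ S ∈ Finset.Ico (m + 1) (m + 1 + n), (m : ℝ) / (((S : ℝ) - m) * S) := by
        refine Finset.sum_le_sum_of_subset_of_nonneg (fun S hS => ?_) fun S hS _ => ?_
        · obtain ⟨h1, h2⟩ := Finset.mem_filter.1 hS
          have := (Finset.mem_Ico.1 h1).2
          exact Finset.mem_Ico.2 ⟨h2, by omega⟩
        · have h1 : (m : ℝ) < S := Nat.cast_lt.2 (Finset.mem_Ico.1 hS).1
          have := sub_pos.2 h1
          positivity
    _ = ∑ k ∈ Finset.range n, (m : ℝ) / (((k : ℝ) + 1) * (m + k + 1)) := by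
        rw [Finset.sum_Ico_eq_sum_range, Nat.add_sub_cancel_left]
        refine Finset.sum_congr rfl fun k _ => ?_
        push_cast
        congr 2 <;> ring
    _ = (harmonic n : ℝ) + harmonic m - harmonic (m + n) := sum_div_mul_add_eq m n
    _ ≤ harmonic m := by
        have : (harmonic n : ℝ) ≤ harmonic (m + n) := by
          norm_cast
          unfold harmonic
          exact Finset.sum_le_sum_of_subset_of_nonneg
            (Finset.range_mono (Nat.le_add_left n m)) fun i _ _ => by positivity
        linarith
    _ ≤ 1 + Real.log m := harmonic_le_one_add_log m

end NNRW

namespace NNRW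

/-! ### Iterated logarithms -/

lemma tendsto_iterLog (j : ℕ) : Tendsto (iterLog j) atTop atTop := by
  induction j with
  | zero => exact tendsto_id
  | succ j ih => exact Real.tendsto_log_atTop.comp ih

lemma tendsto_iterLog_natCast (j : ℕ) : Tendsto (fun R : ℕ => iterLog j R) atTop atTop :=
  (tendsto_iterLog j).comp tendsto_natCast_atTop_atTop

lemma eventually_one_le_iterLog (N : ℕ) :
    ∀ᶠ R : ℕ in atTop, ∀ j ≤ N, 1 ≤ iterLog j R := by
  have h : ∀ j ∈ Set.Iic N, ∀ᶠ R : ℕ in atTop, 1 ≤ iterLog j R := fun j _ =>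
    (tendsto_iterLog_natCast j).eventually_ge_atTop 1
  exact (eventually_all_finite (Set.finite_Iic N)).2 h

lemma eventually_one_le_iterLog_succ (N : ℕ) :
    ∀ᶠ R : ℕ in atTop, ∀ j ≤ N, 1 ≤ iterLog j (R + 1 : ℕ) :=
  (tendsto_add_atTop_nat 1).eventually (eventually_one_le_iterLog N)

lemma lam_pos {N : ℕ} {x : ℝ} (h : ∀ j < N, 1 ≤ iterLog j x) : 0 < lam N x := by
  induction N with
  | zero => exact one_pos
  | succ N ih =>
    exact mul_pos (ih fun j hj => h j (by omega)) (one_pos.trans_le (h N (by omega)))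

lemma lam_mono {M N : ℕ} {x : ℝ} (hMN : M ≤ N) (h : ∀ j < N, 1 ≤ iterLog j x) :
    lam M x ≤ lam N x := by
  induction N, hMN using Nat.le_induction with
  | base => exact le_rfl
  | succ N hMN ih =>
    refine (ih fun j hj => h j (by omega)).trans ?_
    exact le_mul_of_one_le_right (lam_pos fun j hj => h j (by omega)).le (h N (by omega))

lemma iterLog_le {N : ℕ} {x : ℝ} (h : ∀ j < N, 1 ≤ iterLog j x) : iterLog N x ≤ x := by
  induction N with
  | zero => exact le_rfl
  | succ N ih =>
    have h1 := Real.log_le_sub_one_of_pos (one_pos.trans_le (h N (by omega)))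
    have h2 := ih fun j hj => h j (by omega)
    change Real.log (iterLog N x) ≤ x
    linarith

lemma iterLog_sub_le {N : ℕ} {x : ℝ} (h : ∀ j < N, 1 ≤ iterLog j x)
    (h' : ∀ j < N, 1 ≤ iterLog j (x + 1)) :
    iterLog N (x + 1) - iterLog N x ≤ 1 / lam N x := by
  induction N with
  | zero => simp [iterLog, lam]
  | succ N ih =>
    have h1 := one_pos.trans_le (h N (by omega))
    have h2 := one_pos.trans_le (h' N (by omega))
    have h3 := ih (fun j hj => h j (by omega)) fun j hj => h' j (by omega)
    have h4 := Real.log_le_sub_one_of_pos (div_pos h2 h1)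
    rw [Real.log_div h2.ne' h1.ne', div_sub_one h1.ne'] at h4
    change Real.log (iterLog N (x + 1)) - Real.log (iterLog N x) ≤ 1 / (lam N x * iterLog N x)
    rw [← div_div]
    exact h4.trans (div_le_div_of_nonneg_right h3 h1.le)

lemma le_iterLog_sub {N : ℕ} {x : ℝ} (h : ∀ j < N, 1 ≤ iterLog j x)
    (h' : ∀ j < N, 1 ≤ iterLog j (x + 1)) :
    1 / lam N (x + 1) ≤ iterLog N (x + 1) - iterLog N x := by
  induction N with
  | zero => simp [iterLog, lam]
  | succ N ih =>
    have h1 := one_pos.trans_le (h N (by omega))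
    have h2 := one_pos.trans_le (h' N (by omega))
    have h3 := ih (fun j hj => h j (by omega)) fun j hj => h' j (by omega)
    have h4 := Real.log_le_sub_one_of_pos (div_pos h1 h2)
    rw [Real.log_div h1.ne' h2.ne', div_sub_one h2.ne'] at h4
    change 1 / (lam N (x + 1) * iterLog N (x + 1)) ≤
      Real.log (iterLog N (x + 1)) - Real.log (iterLog N x)
    rw [← div_div]
    have h5 := div_le_div_of_nonneg_right h3 h2.le
    have h6 : (iterLog N x - iterLog N (x + 1)) / iterLog N (x + 1) =
      -((iterLog N (x + 1) - iterLog N x) / iterLog N (x + 1)) := by ring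
    linarith

lemma not_summable_of_sub_le {a u : ℕ → ℝ} (hu : Tendsto u atTop atTop)
    (h : ∀ᶠ R in atTop, u (R + 1) - u R ≤ a R) : ¬ Summable a := by
  intro hs
  obtain ⟨R₀, hR₀⟩ := eventually_atTop.1 h
  have h1 := ((summable_nat_add_iff R₀).2 hs).hasSum.tendsto_sum_nat
  refine not_tendsto_nhds_of_tendsto_atTop ?_ _ h1
  have h2 : Tendsto (fun n => u (n + R₀) - u (0 + R₀)) atTop atTop :=
    tendsto_atTop_add_const_right _ _ ((tendsto_add_atTop_iff_nat R₀).2 hu)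
  refine tendsto_atTop_mono (fun n => ?_) h2
  rw [← Finset.sum_range_sub (fun n => u (n + R₀))]
  refine Finset.sum_le_sum fun i _ => ?_
  have := hR₀ (i + R₀) (Nat.le_add_left _ _)
  rwa [add_right_comm] at this

lemma summable_of_le_sub {a v : ℕ → ℝ} (ha : ∀ R, 0 ≤ a R) (hv : ∀ R, 0 ≤ v R)
    (h : ∀ᶠ R in atTop, a (R + 1) ≤ v R - v (R + 1)) : Summable a := by
  obtain ⟨R₀, hR₀⟩ := eventually_atTop.1 h
  rw [← summable_nat_add_iff (R₀ + 1)]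
  refine summable_of_sum_range_le (c := v (0 + R₀)) (fun n => ha _) fun n => ?_
  have h1 : ∑ i ∈ Finset.range n, a (i + (R₀ + 1)) ≤
      ∑ i ∈ Finset.range n, (v (i + R₀) - v (i + 1 + R₀)) := by
    refine Finset.sum_le_sum fun i _ => ?_
    have := hR₀ (i + R₀) (Nat.le_add_left _ _)
    rwa [← add_assoc, add_right_comm i 1]
  rw [Finset.sum_range_sub' (fun n => v (n + R₀))] at h1
  linarith [hv (n + R₀)]

/-- The order of magnitude of the probability of a long stretch of sites visited once. -/
def rate (N : ℕ) (ε : ℝ) (R : ℕ) : ℝ := 1 / (lam N R * Real.exp (ε * iterLog N R))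

lemma rate_pos {N R : ℕ} (ε : ℝ) (h : ∀ j < N, 1 ≤ iterLog j R) : 0 < rate N ε R :=
  one_div_pos.2 (mul_pos (lam_pos h) (Real.exp_pos _))

lemma not_summable_of_rate_le {N : ℕ} {a : ℕ → ℝ} {c : ℝ} (hc : 0 < c)
    (h : ∀ᶠ R in atTop, c * rate N 0 R ≤ a R) : ¬ Summable a := by
  refine not_summable_of_sub_le ((tendsto_iterLog_natCast N).const_mul_atTop hc) ?_
  filter_upwards [h, eventually_one_le_iterLog N, eventually_one_le_iterLog_succ N]
    with R hR h1 h2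
  refine le_trans ?_ hR
  rw [← mul_sub]
  refine mul_le_mul_of_nonneg_left ?_ hc.le
  push_cast at h2 ⊢
  rw [rate, zero_mul, Real.exp_zero, mul_one]
  exact iterLog_sub_le (fun j hj => h1 j hj.le) fun j hj => h2 j hj.le

lemma summable_of_le_rate {N : ℕ} {a : ℕ → ℝ} {C ε : ℝ} (hε : 0 < ε) (hC : 0 ≤ C)
    (ha : ∀ R, 0 ≤ a R) (h : ∀ᶠ R in atTop, a R ≤ C * rate N ε R) : Summable a := by
  refine summable_of_le_sub (v := fun R => C / ε * Real.exp (-(ε * iterLog N R))) ha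
    (fun R => by positivity) ?_
  filter_upwards [(tendsto_add_atTop_nat 1).eventually h, eventually_one_le_iterLog N,
    eventually_one_le_iterLog_succ N] with R hR h1 h2
  refine hR.trans ?_
  rw [← mul_sub, div_mul_eq_mul_div, mul_div_assoc]
  refine mul_le_mul_of_nonneg_left ?_ hC
  rw [le_div_iff₀ hε, rate]
  push_cast at h2 ⊢
  have h3 := le_iterLog_sub (N := N) (fun j hj => h1 j hj.le) fun j hj => h2 j hj.le
  set y := iterLog N (R : ℝ)
  set y' := iterLog N ((R : ℝ) + 1)
  have h4 : Real.exp (-(ε * y)) = Real.exp (-(ε * y')) * Real.exp (ε * (y' - y)) := by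
    rw [← Real.exp_add]
    congr 1
    ring
  have h5 := Real.add_one_le_exp (ε * (y' - y))
  rw [h4, ← div_div, div_eq_mul_inv, ← Real.exp_neg]
  have h6 := mul_le_mul_of_nonneg_left h3 hε.le
  have h7 : ε * (1 / lam N ((R : ℝ) + 1)) ≤ Real.exp (ε * (y' - y)) - 1 := by linarith
  have h8 := mul_le_mul_of_nonneg_left h7 (Real.exp_pos (-(ε * y'))).le
  linarith

lemma mul_exp_sum_iterLog {N : ℕ} (hN : 1 ≤ N) {x : ℝ} (h : ∀ j < N, 1 ≤ iterLog j x) :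
    x * Real.exp (∑ j ∈ Finset.Icc 2 N, iterLog j x) = lam N x := by
  induction N, hN using Nat.le_induction with
  | base => simp [lam, iterLog]
  | succ N hN ih =>
    rw [Finset.sum_Icc_succ_top (by omega), Real.exp_add, ← mul_assoc,
      ih fun j hj => h j (by omega)]
    change _ * Real.exp (Real.log _) = _
    rw [Real.exp_log (one_pos.trans_le (h N (by omega)))]
    rfl

lemma exp_neg_fNR {N R : ℕ} (hN : 1 ≤ N) (ε : ℝ) (h : ∀ j < N, 1 ≤ iterLog j R) :
    Real.exp (-(Real.log 2 * fNR N R ε)) = R * rate N ε R := by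
  have h2 : Real.log 2 ≠ 0 := (Real.log_pos one_lt_two).ne'
  have hR : (1 : ℝ) ≤ R := h 0 (by omega)
  have hR0 : (R : ℝ) ≠ 0 := by linarith
  rw [fNR, ← mul_assoc, mul_one_div_cancel h2, one_mul, Real.exp_neg, Real.exp_add, rate,
    ← mul_exp_sum_iterLog hN h]
  field_simp

lemma fNR_nonneg {N R : ℕ} {ε : ℝ} (hε : 0 ≤ ε) (h : ∀ j ≤ N, 1 ≤ iterLog j R) :
    0 ≤ fNR N R ε := by
  have h2 : 0 < Real.log 2 := Real.log_pos one_lt_two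
  have h3 : 0 ≤ ∑ j ∈ Finset.Icc 2 N, iterLog j (R : ℝ) :=
    Finset.sum_nonneg fun j hj => zero_le_one.trans (h j (Finset.mem_Icc.1 hj).2)
  have h4 : 0 ≤ ε * iterLog N R := mul_nonneg hε (zero_le_one.trans (h N le_rfl))
  unfold fNR
  positivity

lemma fNR_le {N R : ℕ} {ε : ℝ} (hε : 0 ≤ ε) (h : ∀ j ≤ N, 1 ≤ iterLog j R) :
    fNR N R ε ≤ (N + ε) / Real.log 2 * R := by
  have h2 : 0 < Real.log 2 := Real.log_pos one_lt_two
  have hR : (1 : ℝ) ≤ R := h 0 (Nat.zero_le _)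
  have h3 : ∑ j ∈ Finset.Icc 2 N, iterLog j (R : ℝ) ≤ N * R := by
    refine (Finset.sum_le_card_nsmul _ _ (R : ℝ) fun j hj => iterLog_le fun i hi => h i ?_).trans ?_
    · have := (Finset.mem_Icc.1 hj).2
      omega
    · rw [Nat.card_Icc, nsmul_eq_mul]
      gcongr
      omega
  have h4 : ε * iterLog N R ≤ ε * R :=
    mul_le_mul_of_nonneg_left (iterLog_le fun i hi => h i hi.le) hε
  rw [fNR, one_div_mul_eq_div, div_mul_eq_mul_div]
  gcongr
  linarith

end NNRW

namespace NNRW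

/-! ### Probabilities of long stretches of sites visited once -/

lemma prod_E_le {B : ℝ} (hB : 1 < B) {p : ℕ → ℝ} {i₁ : ℕ} (hE : DriftFrom B p i₁) {R : ℕ}
    (hR : i₁ < R) (l : ℕ) :
    ∏ i ∈ Finset.range l, E p (R + i) ≤ (1 / 2) ^ l * Real.exp (l * (B / (2 * R))) := by
  have hR0 : (0 : ℝ) < R := Nat.cast_pos.2 (by omega)
  rw [Real.exp_nat_mul, ← mul_pow]
  calc ∏ i ∈ Finset.range l, E p (R + i)
      ≤ ∏ _i ∈ Finset.range l, (1 / 2 * Real.exp (B / (2 * R))) := by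
        refine Finset.prod_le_prod (fun i _ => ?_) fun i _ => ?_
        · rw [(hE (R + i) (by omega)).1]
          positivity
        · rw [(hE (R + i) (by omega)).1]
          have h1 := Real.add_one_le_exp (B / (2 * R))
          have h2 : B / (4 * (R + i : ℕ)) ≤ B / (4 * R) := by
            gcongr
            omega
          have h3 : B / (2 * R) = 2 * (B / (4 * R)) := by
            field_simp
            norm_num
          linarith
    _ = _ := by rw [Finset.prod_const, Finset.card_range]

lemma le_prod_E {p : ℕ → ℝ} (hp : ∀ i, 1 ≤ i → 0 ≤ p i ∧ p i < 1 / 2) (R l : ℕ) :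
    (1 / 2) ^ l ≤ ∏ i ∈ Finset.range l, E p (R + i) := by
  calc (1 / 2 : ℝ) ^ l = ∏ _i ∈ Finset.range l, (1 / 2 : ℝ) := by
        rw [Finset.prod_const, Finset.card_range]
    _ ≤ _ := Finset.prod_le_prod (fun i _ => by norm_num) fun i _ => (E_mem hp (R + i)).1

lemma prod_E_le_pow {B : ℝ} {p : ℕ → ℝ} {i₁ : ℕ} (hB : 1 < B) (hE : DriftFrom B p i₁) {R : ℕ}
    (hR : i₁ < R) (hRB : B ≤ R) (l : ℕ) :
    ∏ i ∈ Finset.range l, E p (R + i) ≤ (3 / 4) ^ l := by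
  have hR0 : (0 : ℝ) < R := by linarith
  calc ∏ i ∈ Finset.range l, E p (R + i) ≤ ∏ _i ∈ Finset.range l, (3 / 4 : ℝ) := by
        refine Finset.prod_le_prod (fun i _ => ?_) fun i _ => ?_ <;>
          rw [(hE (R + i) (by omega)).1]
        · positivity
        · have : B / (4 * (R + i : ℕ)) ≤ 1 / 4 := by
            rw [div_le_iff₀ (by push_cast; positivity)]
            push_cast
            have : (0 : ℝ) ≤ i := Nat.cast_nonneg i
            linarith
          linarith
    _ = _ := by rw [Finset.prod_const, Finset.card_range]

lemma half_pow_eq (n : ℕ) : (1 / 2 : ℝ) ^ n = Real.exp (-(Real.log 2 * n)) := by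
  rw [← neg_mul, mul_comm, Real.exp_nat_mul, Real.exp_neg, Real.exp_log two_pos, one_div]

lemma half_pow_floor_succ_le {f : ℝ} : (1 / 2 : ℝ) ^ (⌊f⌋₊ + 1) ≤ Real.exp (-(Real.log 2 * f)) := by
  rw [half_pow_eq]
  have h1 := Nat.lt_floor_add_one f
  have h2 : 0 ≤ Real.log 2 := (Real.log_pos one_lt_two).le
  push_cast
  gcongr

lemma le_half_pow_floor_succ {f : ℝ} (hf : 0 ≤ f) :
    Real.exp (-(Real.log 2 * f)) / 2 ≤ (1 / 2 : ℝ) ^ (⌊f⌋₊ + 1) := by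
  have h3 : Real.exp (-(Real.log 2 * f)) ≤ (1 / 2 : ℝ) ^ ⌊f⌋₊ := by
    rw [half_pow_eq]
    have h1 := Nat.floor_le hf
    have h2 : 0 ≤ Real.log 2 := (Real.log_pos one_lt_two).le
    gcongr
  rw [pow_succ]
  linarith

lemma lin_le {B : ℝ} (hB : 1 < B) {m : ℕ} {x K : ℝ} (hx : 1 ≤ x) (hm : m ≤ K * x) :
    lin B m ≤ (2 * K + B) / (2 * (B - 1)) * x := by
  rw [lin, div_mul_eq_mul_div]
  have : 0 < 2 * (B - 1) := by linarith
  gcongr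
  nlinarith

/-- The length `⌊f(N, R, ε)⌋`. -/
def len (N : ℕ) (ε : ℝ) (R : ℕ) : ℕ := ⌊fNR N R ε⌋₊

namespace IsMarkovFamily

variable {p : ℕ → ℝ} {μ : ℕ → Measure (ℕ → ℕ)}

lemma above_le_div {B : ℝ} (hB : 1 < B) {i₁ : ℕ} (hE : DriftFrom B p i₁)
    (hp : ∀ i, 1 ≤ i → 0 ≤ p i ∧ p i < 1 / 2) (h : IsMarkovFamily p μ) {m : ℕ} (hm : i₁ ≤ m)
    (hm0 : 0 < m) : (μ (m + 1)).real (above m) ≤ (B + 1) / m := by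
  refine (h.above_le hB hE hp hm (show m < 2 * m by omega)).trans ?_
  have hm' : (0 : ℝ) < m := Nat.cast_pos.2 hm0
  have hB' : 0 < B - 1 := by linarith
  unfold lin
  push_cast
  rw [show 2 * (m : ℝ) - m = m by ring, one_div_div]
  have h1 : 2 * (B - 1) / (2 * m + B) * (1 + (2 * (2 * m) + B) / (2 * (B - 1)) / m) =
      (2 * (B - 1) * m + (4 * m + B)) / (m * (2 * m + B)) := by
    field_simp
    ring
  rw [h1, div_le_div_iff₀ (by positivity) hm']
  nlinarith [mul_pos hm' hm', mul_pos (mul_pos hm' hm') hB', mul_pos hm' hB']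

lemma exists_cut_le {B : ℝ} (hB : 1 < B) {i₁ : ℕ} (hE : DriftFrom B p i₁)
    (hp : ∀ i, 1 ≤ i → 0 ≤ p i ∧ p i < 1 / 2) (h : IsMarkovFamily p μ) {N : ℕ} (hN : 1 ≤ N)
    {ε : ℝ} (hε : 0 ≤ ε) :
    ∃ C, 0 ≤ C ∧ ∀ᶠ R in atTop, (μ 0).real (cut (len N ε) R) ≤ C * rate N ε R := by
  set K := (N + ε) / Real.log 2 with hK
  refine ⟨Real.exp ((K + 1) * (B / 2)) * (B + 1), by positivity, ?_⟩
  filter_upwards [eventually_one_le_iterLog N, eventually_gt_atTop i₁] with R hR hR₁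
  have hR1 : (1 : ℝ) ≤ R := hR 0 (Nat.zero_le _)
  have hR0 : (0 : ℝ) < R := by linarith
  have hf := fNR_nonneg hε hR
  have hL : ((len N ε R + 1 : ℕ) : ℝ) ≤ (K + 1) * R := by
    have h1 := Nat.floor_le hf
    have h2 := fNR_le hε hR
    rw [← hK] at h2
    rw [len]
    push_cast
    linarith
  rw [h.cut_real hp]
  have hab : (μ (R + len N ε R + 1)).real (above (R + len N ε R)) ≤ (B + 1) / R := by
    refine (h.above_le_div hB hE hp (by omega) (by omega)).trans ?_
    gcongr
    exact Nat.le_add_right _ _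
  have hprod := prod_E_le hB hE hR₁ (len N ε R + 1)
  have h3 : ((len N ε R + 1 : ℕ) : ℝ) * (B / (2 * R)) ≤ (K + 1) * (B / 2) := by
    calc ((len N ε R + 1 : ℕ) : ℝ) * (B / (2 * R)) ≤ (K + 1) * R * (B / (2 * R)) := by gcongr
      _ = (K + 1) * (B / 2) := by field_simp
  have h4 : (1 / 2 : ℝ) ^ (len N ε R + 1) ≤ R * rate N ε R := by
    rw [← exp_neg_fNR hN ε fun j hj => hR j hj.le]
    exact half_pow_floor_succ_le
  have h5 := rate_pos ε fun j hj => hR j (Nat.le_of_lt hj)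
  calc _ ≤ ((1 / 2) ^ (len N ε R + 1) * Real.exp ((len N ε R + 1 : ℕ) * (B / (2 * R)))) *
        ((B + 1) / R) := by gcongr
    _ ≤ (R * rate N ε R * Real.exp ((K + 1) * (B / 2))) * ((B + 1) / R) := by
        gcongr
    _ = _ := by field_simp

lemma exists_le_cut {B : ℝ} (hB : 1 < B) {i₁ : ℕ} (hE : DriftFrom B p i₁)
    (hp : ∀ i, 1 ≤ i → 0 ≤ p i ∧ p i < 1 / 2) (h : IsMarkovFamily p μ) {N : ℕ} (hN : 1 ≤ N)
    {ε : ℝ} (hε : 0 ≤ ε) :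
    ∃ c, 0 < c ∧ ∀ᶠ R in atTop, c * rate N ε R ≤ (μ 0).real (cut (len N ε) R) := by
  set K := (N + ε) / Real.log 2 with hK
  have h2 : 0 < Real.log 2 := Real.log_pos one_lt_two
  have hK0 : 0 ≤ K := by positivity
  have hB' : 0 < B - 1 := by linarith
  set D := (2 * (K + 1) + B) / (2 * (B - 1))
  have hD : 0 < D := by positivity
  refine ⟨1 / (2 * D), by positivity, ?_⟩
  filter_upwards [eventually_one_le_iterLog N, eventually_gt_atTop i₁] with R hR hR₁
  have hR1 : (1 : ℝ) ≤ R := hR 0 (Nat.zero_le _)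
  have hR0 : (0 : ℝ) < R := by linarith
  have hf := fNR_nonneg hε hR
  have hL : ((R + len N ε R : ℕ) : ℝ) ≤ (K + 1) * R := by
    have h1 := Nat.floor_le hf
    have h2 := fNR_le hε hR
    rw [← hK] at h2
    rw [len]
    push_cast
    linarith
  rw [h.cut_real hp]
  have hab : 1 / (D * R) ≤ (μ (R + len N ε R + 1)).real (above (R + len N ε R)) :=
    (one_div_le_one_div_of_le (lin_pos hB _) (lin_le hB hR1 hL)).trans
      (h.le_above hB hE hp (by omega))
  have h4 : R * rate N ε R / 2 ≤ (1 / 2 : ℝ) ^ (len N ε R + 1) := by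
    rw [← exp_neg_fNR hN ε fun j hj => hR j hj.le]
    exact le_half_pow_floor_succ hf
  have h5 := rate_pos ε fun j hj => hR j (Nat.le_of_lt hj)
  calc 1 / (2 * D) * rate N ε R = R * rate N ε R / 2 * (1 / (D * R)) := by field_simp
    _ ≤ _ := mul_le_mul (h4.trans (le_prod_E hp R _)) hab (by positivity)
        ((by positivity : (0 : ℝ) ≤ (1 / 2) ^ (len N ε R + 1)).trans (le_prod_E hp R _))

lemma limsup_cut {B : ℝ} (hB : 1 < B) {i₁ : ℕ} (hE : DriftFrom B p i₁)
    (hp : ∀ i, 1 ≤ i → 0 ≤ p i ∧ p i < 1 / 2) (h : IsMarkovFamily p μ) {N : ℕ} (hN : 2 ≤ N) :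
    μ 0 (limsup (cut (len N 0)) atTop) = 1 := by
  refine (h.limsup_cut_zero_one hp (len N 0) 0).resolve_left ?_
  have := h.prob 0
  obtain ⟨c, hc, hle⟩ := h.exists_le_cut hB hE hp (show 1 ≤ N by omega) le_rfl
  obtain ⟨C, hC, hge⟩ := h.exists_cut_le hB hE hp (show 1 ≤ N by omega) le_rfl
  obtain ⟨M₀, hM₀⟩ := eventually_atTop.1 ((hge.and (eventually_one_le_iterLog N)).and
    ((eventually_gt_atTop i₁).and (eventually_ge_atTop ⌈B⌉₊)))
  set a : ℕ → ℝ := fun R => (μ 0).real (cut (len N 0) R)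
  have ha0 : ∀ R, 0 ≤ a R := fun R => measureReal_nonneg
  have hB' : 0 < B - 1 := by linarith
  set D := (2 * 1 + B) / (2 * (B - 1))
  have hD : 0 < D := by positivity
  have hlog : ∀ R, M₀ ≤ R → 1 ≤ Real.log R := fun R hR => (hM₀ R hR).1.2 1 (by omega)
  have ha : ∀ S, M₀ ≤ S → a S ≤ C / (S * Real.log S) := by
    intro S hS
    have h1 := lam_mono (x := (S : ℝ)) hN fun j hj => (hM₀ S hS).1.2 j hj.le
    have h2 : lam 2 (S : ℝ) = S * Real.log S := by simp [lam, iterLog]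
    have h3 : 0 < lam 2 (S : ℝ) := lam_pos fun j hj => (hM₀ S hS).1.2 j (by omega)
    refine (hM₀ S hS).1.1.trans ?_
    rw [rate, zero_mul, Real.exp_zero, mul_one, mul_one_div, ← h2]
    gcongr
  set L := len N 0
  set t : ℕ → ℕ → ℝ := fun R S =>
    if R + L R < S then ((R + L R : ℕ) : ℝ) / (((S : ℝ) - (R + L R : ℕ)) * S) else 0 with ht
  have ht0 : ∀ R S, 0 ≤ t R S := by
    intro R S
    simp only [ht]
    split_ifs with h1
    · have h2 : ((R + L R : ℕ) : ℝ) < S := Nat.cast_lt.2 h1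
      have := sub_pos.2 h2
      positivity
    · exact le_rfl
  refine measure_limsup_ne_zero_of_pair_le (fun R => measurableSet_cut _ R)
    (not_summable_of_rate_le hc hle) (r := 3 / 4) (K := C * D * 2) (D := 1 + 1 / (B - 1))
    (c := fun R S => C * D * (t R S / Real.log (R + L R : ℕ))) (M₀ := M₀) (by norm_num)
    (by norm_num) (by positivity) (by positivity) (fun R S => ?_) (fun M hM R hR n => ?_)
    fun R hR S hRS => ?_
  · have := ht0 R S
    have := Real.log_natCast_nonneg (R + L R)
    positivity
  · rw [← Finset.mul_sum, ← Finset.sum_div]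
    refine mul_le_mul_of_nonneg_left ?_ (by positivity)
    have h1 := hlog (R + L R) (by omega)
    rw [div_le_iff₀ (by linarith)]
    have h2 := sum_div_sub_mul_le M n (R + L R)
    simp only [ht]
    linarith
  · have hlog0 := Real.log_natCast_nonneg (R + L R)
    have hc0 : 0 ≤ a R * (C * D * (t R S / Real.log (R + L R : ℕ))) := by
      have := ht0 R S
      have := ha0 R
      positivity
    have hd0 : 0 ≤ (1 + 1 / (B - 1)) * (a R * a S) := by
      have := ha0 R
      have := ha0 S
      positivity
    have hr0 : 0 ≤ (3 / 4) ^ (S - R) * a S := by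
      have := ha0 S
      positivity
    rcases hRS.eq_or_lt with rfl | hlt
    · rw [Set.inter_self, Nat.sub_self, pow_zero, one_mul, add_assoc]
      exact le_add_of_nonneg_right (add_nonneg hd0 hc0)
    rcases le_or_gt S (R + L R) with hS | hS
    · have h1 := h.cut_inter_near hp hlt hS
      have h2 := prod_E_le_pow hB hE (hM₀ R hR).2.1
        ((Nat.le_ceil B).trans (Nat.cast_le.2 (hM₀ R hR).2.2)) (S - R)
      have h3 := h1.trans (mul_le_mul_of_nonneg_right h2 (ha0 S))
      linarith
    · have h1 := h.cut_inter_far hB hE hp (hM₀ R hR).2.1.le hS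
      set m := R + L R with hm
      have hmS : (0 : ℝ) < (S : ℝ) - m := sub_pos.2 (Nat.cast_lt.2 hS)
      have hm1 : (1 : ℝ) ≤ m := (hM₀ m (by omega)).1.2 0 (Nat.zero_le _)
      have hlin : lin B S / ((S : ℝ) - m) = 1 / (B - 1) + lin B m / ((S : ℝ) - m) := by
        unfold lin
        field_simp
        ring
      have hlm : lin B m ≤ D * m := lin_le hB hm1 (by rw [one_mul])
      have hlogm := hlog m (by omega)
      have hlogS : Real.log m ≤ Real.log S :=
        Real.log_le_log (by linarith) (by linarith)
      have hS0 : (0 : ℝ) < S := by linarith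
      have key : a S * (lin B m / ((S : ℝ) - m)) ≤ C * D * (t R S / Real.log m) := by
        calc a S * (lin B m / ((S : ℝ) - m))
            ≤ C / (S * Real.log m) * (D * m / ((S : ℝ) - m)) := by
              refine mul_le_mul ((ha S (by omega)).trans ?_) ?_
                (div_nonneg (lin_pos hB m).le hmS.le) (by positivity)
              · gcongr
              · gcongr
          _ = _ := by
              simp only [ht, ← hm, if_pos hS]
              field_simp
      have h2 := mul_le_mul_of_nonneg_left key (ha0 R)
      rw [hlin] at h1
      have h3 : a R * a S * (1 + (1 / (B - 1) + lin B m / ((S : ℝ) - m))) =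
          (1 + 1 / (B - 1)) * (a R * a S) + a R * (a S * (lin B m / ((S : ℝ) - m))) := by ring
      change (μ 0).real (cut L R ∩ cut L S) ≤
        a R * a S * (1 + (1 / (B - 1) + lin B m / ((S : ℝ) - m))) at h1
      change (μ 0).real (cut L R ∩ cut L S) ≤ (3 / 4) ^ (S - R) * a S +
        (1 + 1 / (B - 1)) * (a R * a S) + a R * (C * D * (t R S / Real.log m))
      linarith

lemma ae_eventually_notMem_cut {B : ℝ} (hB : 1 < B) {i₁ : ℕ} (hE : DriftFrom B p i₁)
    (hp : ∀ i, 1 ≤ i → 0 ≤ p i ∧ p i < 1 / 2) (h : IsMarkovFamily p μ) {N : ℕ} (hN : 1 ≤ N)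
    {ε : ℝ} (hε : 0 < ε) : ∀ᵐ w ∂μ 0, ∀ᶠ R in atTop, w ∉ cut (len N ε) R := by
  have := h.prob 0
  obtain ⟨C, hC, hge⟩ := h.exists_cut_le hB hE hp hN hε.le
  have hs := summable_of_le_rate hε hC (fun R => measureReal_nonneg) hge
  refine ae_eventually_notMem ?_
  have h1 : ∀ R, μ 0 (cut (len N ε) R) = ENNReal.ofReal ((μ 0).real (cut (len N ε) R)) :=
    fun R => (ENNReal.ofReal_toReal (measure_ne_top _ _)).symm
  simp only [h1]
  rw [← ENNReal.ofReal_tsum_of_nonneg (fun R => measureReal_nonneg) hs]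
  exact ENNReal.ofReal_ne_top

end IsMarkovFamily

lemma IsTruncation.driftFrom {B : ℝ} {p : ℕ → ℝ}
    (htr : IsTruncation (fun i : ℕ => B / (4 * (i : ℝ))) p) :
    ∃ i₁, DriftFrom B p i₁ := by
  obtain ⟨i₀, h1, h2, -, -, h3⟩ := htr
  refine ⟨i₀, fun i hi => ⟨?_, ?_⟩⟩
  · rw [E, if_neg (by omega), h3 i hi]
  · have hi₀ : (0 : ℝ) < i₀ := Nat.cast_pos.2 (by omega)
    have hi' : (i₀ : ℝ) < i := Nat.cast_lt.2 hi
    beta_reduce at h2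
    rw [div_lt_iff₀ (by positivity)] at h2
    linarith

end NNRW

/-- for `p_R = B/(4R)` (truncation convention), `B > 1`, `N ≥ 2`:
(i) a.s. there are infinitely many `R` with `ξ(R+j,∞) = 1` for all `0 ≤ j ≤ ⌊g(N,R)⌋`;
(ii) for every `ε > 0`, a.s. for all large `R` there is `S` with `R ≤ S ≤ R + f(N,R,ε)`
and `ξ(S,∞) > 1`. -/
theorem stmt18 (B : ℝ) (hB : 1 < B) (p : ℕ → ℝ)
    (hp : ∀ i, 1 ≤ i → 0 ≤ p i ∧ p i < 1 / 2)
    (htr : IsTruncation (fun i : ℕ => B / (4 * (i : ℝ))) p)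
    (N : ℕ) (hN : 2 ≤ N)
    (Ω : Type) [MeasurableSpace Ω] (P : Measure Ω) [IsProbabilityMeasure P]
    (X : ℕ → Ω → ℕ) (hX : IsNNWalk P X p 0) :
    (∀ᵐ ω ∂P, ∃ᶠ R : ℕ in atTop,
        ∀ j : ℕ, j ≤ ⌊fNR N R 0⌋₊ → localTime X (R + j) ω = 1) ∧
      ∀ ε : ℝ, 0 < ε → ∀ᵐ ω ∂P, ∀ᶠ R : ℕ in atTop,
        ∃ S : ℕ, R ≤ S ∧ (S : ℝ) ≤ (R : ℝ) + fNR N R ε ∧ 1 < localTime X S ω := by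
  obtain ⟨μ, h, hμ⟩ := hX.exists_isMarkovFamily hp
  have := h.prob 0
  obtain ⟨i₁, hE⟩ := htr.driftFrom
  have hmeas := hX.aemeasurable hp
  constructor
  · have h1 : ∀ᵐ w ∂μ 0, w ∈ limsup (cut (len N 0)) atTop :=
      (prob_compl_eq_zero_iff
        (MeasurableSet.measurableSet_limsup fun R => measurableSet_cut _ R)).2
        (h.limsup_cut hB hE hp hN)
    rw [hμ] at h1
    filter_upwards [ae_of_ae_map hmeas h1] with ω hω
    exact (mem_limsup_iff_frequently_mem.1 hω).mono fun R hR j hj =>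
      localTime_eq_one_of_mem_cut hR hj
  · intro ε hε
    have h1 : ∀ᵐ w ∂μ 0, ∀ᶠ R : ℕ in atTop, ∃ S : ℕ, R ≤ S ∧
        (S : ℝ) ≤ (R : ℝ) + fNR N R ε ∧ 1 < localTime (fun k (w : ℕ → ℕ) => w k) S w := by
      have hhit : ∀ᵐ w ∂μ 0, ∀ x, w ∈ hit (Set.Ici x) {x} Set.univ := by
        rw [ae_all_iff]
        exact fun x => (prob_compl_eq_zero_iff (measurableSet_hit _ _ MeasurableSet.univ)).2
          (h.hit_Ici hp x)
      filter_upwards [h.start 0, h.nearest_neighbour 0, hhit,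
        h.ae_eventually_notMem_cut hB hE hp (show 1 ≤ N by omega) hε] with w h0 hnn hw hcut
      filter_upwards [hcut, eventually_one_le_iterLog N] with R hR hlog
      by_contra hcon
      refine hR (mem_cut_of_localTime_le_one h0 hnn hw fun j hj => not_lt.1 fun hlt =>
        hcon ⟨R + j, Nat.le_add_right _ _, ?_, hlt⟩)
      push_cast
      have h2 := Nat.floor_le (fNR_nonneg hε.le hlog)
      have h3 : (j : ℝ) ≤ ⌊fNR N R ε⌋₊ := Nat.cast_le.2 hj
      linarith
    rw [hμ] at h1
    exact ae_of_ae_map hmeas h1
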